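/- arXiv:2202.00385 — 3 statements merged into one kernel-verified Lean document; each statement's English description precedes it below -/
import Mathlib

section
/- Let k ≥ 1. A chain map g : P• → P•[k] is null-homotopic if and only if g^{(k)} ∈ rad_A(P_k, P_0), i.e. if and only if the image of g^{(k)} : P_k → P_0 is contained in (rad A)P_0. -/
/-!
STATEMENT 3 (Lemma "proj resol" of the paper).

Setting: `K` algebraically closed, `A` a finite-dimensional `K`-algebra with a complete set
of pairwise orthogonal primitive idempotents `e 0, …, e (n-1)`; `P(i) = Ae_i` is encoded as
`leftIdeal A (e i)`, `rad A` as the intersection of maximal left ideals, `rad_A(P,Q)` as the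
homomorphisms with image in `(rad A)·Q`, and the properly standard module `Δ̄(i)` as
`P(i)/U(i)` with `U(i)` the sum of the images of all radical maps `P(j) → P(i)`, `j ≥ i`.

`P•` is a projective resolution of `Δ̄(i)` with `P_0 ≅ P(i)`, each `P_k` (`k ≥ 1`) a finite
direct sum of modules `P(j)` with `j ≥ i`, and all differentials radical maps (minimality).

Chain maps `g : P• → P•[k]` of degree `k = k' + 1 ≥ 1` are encoded by their components
`g m := g^{(m+k)} : P (k'+m+1) →ₗ[A] P m`, with the chain condition
`g^{(l)} ∘ ∂_{l+1} = (-1)^k ∂_{l-k+1} ∘ g^{(l+1)}`; `g` is null-homotopic iff there are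
`u^{(l)} : P_l → P_{l-k+1}` (encoded as `h m := u^{(m+k-1)}`) with
`g^{(l)} = ∂_{l-k+1} ∘ u^{(l)} - (-1)^(k-1) u^{(l-1)} ∘ ∂_l`.
-/

noncomputable section

def mulRightLin (A : Type*) [Ring A] (a : A) : A →ₗ[A] A where
  toFun x := x * a
  map_add' x y := add_mul x y a
  map_smul' r x := by simp [smul_eq_mul, mul_assoc]

def leftIdeal (A : Type*) [Ring A] (a : A) : Submodule A A := LinearMap.range (mulRightLin A a)

def jacRad (A : Type*) [Ring A] : Ideal A := sInf {I : Ideal A | I.IsMaximal}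

def radM (A : Type*) [Ring A] (M : Type*) [AddCommGroup M] [Module A M] : Submodule A M :=
  Submodule.span A {x | ∃ r ∈ jacRad A, ∃ m : M, x = r • m}

def IsRadHom (A : Type*) [Ring A] {M N : Type*} [AddCommGroup M] [Module A M]
    [AddCommGroup N] [Module A N] (f : M →ₗ[A] N) : Prop :=
  LinearMap.range f ≤ radM A N

def IsPrimitiveIdem (A : Type*) [Ring A] (x : A) : Prop :=
  IsIdempotentElem x ∧ x ≠ 0 ∧ ∀ y z : A, IsIdempotentElem y → IsIdempotentElem z →
    y * z = 0 → z * y = 0 → x = y + z → y = 0 ∨ z = 0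

/-- `U(i)`: the sum of the images of all radical maps `P(j) → P(i)` with `j ≥ i` -/
def properU (A : Type*) [Ring A] {n : ℕ} (e : Fin n → A) (i : Fin n) :
    Submodule A ↥(leftIdeal A (e i)) :=
  ⨆ (j : Fin n) (_ : i ≤ j) (φ : ↥(leftIdeal A (e j)) →ₗ[A] ↥(leftIdeal A (e i)))
    (_ : IsRadHom A φ), LinearMap.range φ

/-- the properly standard module `Δ̄(i) = P(i)/U(i)` -/
abbrev PStd (A : Type*) [Ring A] {n : ℕ} (e : Fin n → A) (i : Fin n) :=
  ↥(leftIdeal A (e i)) ⧸ properU A e i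

theorem exists_comp_eq_of_range_le {A M N L : Type*} [Ring A]
    [AddCommGroup M] [Module A M] [AddCommGroup N] [Module A N] [AddCommGroup L] [Module A L]
    [Module.Projective A L] (d : M →ₗ[A] N) (f : L →ₗ[A] N)
    (hf : LinearMap.range f ≤ LinearMap.range d) : ∃ u : L →ₗ[A] M, d ∘ₗ u = f := by
  obtain ⟨u, hu⟩ := Module.projective_lifting_property d.rangeRestrict
    (f.codRestrict (LinearMap.range d) fun x => hf ⟨x, rfl⟩) d.surjective_rangeRestrict
  refine ⟨u, ?_⟩
  ext x
  exact congrArg Subtype.val (LinearMap.congr_fun hu x)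

theorem radM_le_comap {A M N : Type*} [Ring A] [AddCommGroup M] [Module A M]
    [AddCommGroup N] [Module A N] (f : M →ₗ[A] N) : radM A M ≤ (radM A N).comap f := by
  refine Submodule.span_le.mpr ?_
  rintro _ ⟨r, hr, m, rfl⟩
  exact Submodule.subset_span ⟨r, hr, f m, f.map_smul r m⟩

theorem IsRadHom.comp_left {A L M N : Type*} [Ring A] [AddCommGroup L] [Module A L]
    [AddCommGroup M] [Module A M] [AddCommGroup N] [Module A N] {f : L →ₗ[A] M}
    (hf : IsRadHom A f) (g : M →ₗ[A] N) : IsRadHom A (g ∘ₗ f) := by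
  rintro _ ⟨x, rfl⟩
  exact radM_le_comap g (hf ⟨x, rfl⟩)

theorem IsRadHom.comp_right {A L M N : Type*} [Ring A] [AddCommGroup L] [Module A L]
    [AddCommGroup M] [Module A M] [AddCommGroup N] [Module A N] {g : M →ₗ[A] N}
    (hg : IsRadHom A g) (f : L →ₗ[A] M) : IsRadHom A (g ∘ₗ f) :=
  (LinearMap.range_comp_le_range f g).trans hg

/-- A radical map to `P(i)` from a finite direct sum of modules `P(j)`, `j ≥ i`, lands in
`U(i)`. -/
theorem IsRadHom.range_le_properU {A : Type*} [Ring A] {n : ℕ} {e : Fin n → A} {i : Fin n}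
    {m : ℕ} {js : Fin m → Fin n} (hjs : ∀ t, i ≤ js t)
    {f : ((t : Fin m) → ↥(leftIdeal A (e (js t)))) →ₗ[A] ↥(leftIdeal A (e i))}
    (hf : IsRadHom A f) : LinearMap.range f ≤ properU A e i := by
  rintro _ ⟨x, rfl⟩
  rw [← Finset.univ_sum_single x, map_sum]
  refine Submodule.sum_mem _ fun t _ => ?_
  have hmem : f (Pi.single t (x t)) ∈ LinearMap.range
      (f ∘ₗ LinearMap.single A (fun t => ↥(leftIdeal A (e (js t)))) t) := ⟨x t, rfl⟩
  refine (?_ : _ ≤ properU A e i) hmem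
  exact le_iSup_of_le (js t) (le_iSup_of_le (hjs t) (le_iSup_of_le _
    (le_iSup_of_le (hf.comp_right _) le_rfl)))

/-- A degree `k' + 1` chain map into an exact complex is null-homotopic as soon as its lowest
component factors through the last differential. -/
theorem exists_homotopy_of_factor {A : Type*} [Ring A] (P : ℕ → Type*)
    [∀ l, AddCommGroup (P l)] [∀ l, Module A (P l)] (hproj : ∀ l, Module.Projective A (P l))
    (dP : ∀ l, P (l + 1) →ₗ[A] P l) (hex : ∀ l, Function.Exact (dP (l + 1)) (dP l)) (k' : ℕ)
    (g : ∀ m, P (k' + m + 1) →ₗ[A] P m)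
    (hchain : ∀ m, (g m) ∘ₗ (dP (k' + m + 1)) =
      ((-1 : ℤ) ^ (k' + 1)) • ((dP m) ∘ₗ (g (m + 1))))
    (u₀ : P (k' + 0 + 1) →ₗ[A] P 1) (hu₀ : dP 0 ∘ₗ u₀ = g 0) :
    ∃ h : ∀ m, P (k' + m) →ₗ[A] P m,
      ∀ m, g m = ((dP m) ∘ₗ (h (m + 1)) : P (k' + m + 1) →ₗ[A] P m) -
        ((-1 : ℤ) ^ k') • ((h m) ∘ₗ (dP (k' + m))) := by
  have hdd : ∀ l x, dP l (dP (l + 1) x) = 0 := fun l x => (hex l).apply_apply_eq_zero x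
  let Good (m : ℕ) (u : P (k' + m + 1) →ₗ[A] P (m + 1)) : Prop :=
    ∀ x, g m (dP (k' + m + 1) x) = dP m (u (dP (k' + m + 1) x))
  have step : ∀ m (u : {u // Good m u}), ∃ v : {v // Good (m + 1) v},
      g (m + 1) = dP (m + 1) ∘ₗ v.1 - ((-1 : ℤ) ^ k') • (u.1 ∘ₗ dP (k' + m + 1)) := by
    rintro m ⟨u, hu⟩
    have := hproj (k' + (m + 1) + 1)
    obtain ⟨v, hv⟩ := exists_comp_eq_of_range_le (dP (m + 1))
      (g (m + 1) + ((-1 : ℤ) ^ k') • (u ∘ₗ dP (k' + m + 1))) <| by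
        rintro _ ⟨x, rfl⟩
        refine (hex m _).mp ?_
        have h1 := LinearMap.congr_fun (hchain m) x
        have h2 := hu x
        simp only [LinearMap.comp_apply, LinearMap.smul_apply] at h1
        simp only [LinearMap.add_apply, LinearMap.smul_apply, LinearMap.comp_apply, map_add,
          map_zsmul]
        rw [← h2, h1, smul_smul, ← pow_add, show k' + (k' + 1) = 2 * k' + 1 by ring,
          pow_succ, pow_mul]
        simp
    refine ⟨⟨v, fun x => ?_⟩, by rw [hv]; exact (add_sub_cancel_right _ _).symm⟩
    have h1 := LinearMap.congr_fun hv (dP (k' + (m + 1) + 1) x)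
    simp only [LinearMap.add_apply, LinearMap.smul_apply, LinearMap.comp_apply] at h1
    have h2 : dP (k' + m + 1) (dP (k' + (m + 1) + 1) x) = 0 := hdd (k' + m + 1) x
    rw [h1, h2]
    simp
  choose next hnext using step
  let w : ∀ m, {u // Good m u} := fun m => Nat.rec
    ⟨u₀, fun x => (LinearMap.congr_fun hu₀ _).symm⟩ next m
  refine ⟨fun m => Nat.casesOn m 0 fun m => (w m).1, fun m => ?_⟩
  cases m with
  | zero =>
    change g 0 = dP 0 ∘ₗ u₀ - ((-1 : ℤ) ^ k') • ((0 : P k' →ₗ[A] P 0) ∘ₗ dP k')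
    rw [hu₀, LinearMap.zero_comp, smul_zero, sub_zero]
  | succ m => exact hnext m (w m)

theorem stmt3
    {K : Type u} [Field K] [IsAlgClosed K]
    {A : Type u} [Ring A] [Algebra K A] [FiniteDimensional K A]
    (n : ℕ) (e : Fin n → A)
    (hidem : ∀ i, IsPrimitiveIdem A (e i))
    (horth : ∀ i j, i ≠ j → e i * e j = 0)
    (hcomplete : ∑ i, e i = 1)
    (i : Fin n)
    -- `P•` is a projective resolution of `Δ̄(i)` …
    (P : ℕ → Type u) [∀ l, AddCommGroup (P l)] [∀ l, Module A (P l)]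
    (hproj : ∀ l, Module.Projective A (P l))
    (dP : ∀ l, P (l + 1) →ₗ[A] P l)
    (π : P 0 →ₗ[A] PStd A e i)
    (hπ : Function.Surjective π)
    (hex0 : Function.Exact (dP 0) π)
    (hex : ∀ l, Function.Exact (dP (l + 1)) (dP l))
    -- … with `P_0 ≅ P(i)` …
    (hP0 : Nonempty (P 0 ≃ₗ[A] ↥(leftIdeal A (e i))))
    -- … each `P_k`, `k ≥ 1`, a finite direct sum of modules `P(j)` with `j ≥ i` …
    (hPk : ∀ k : ℕ, ∃ (m : ℕ) (js : Fin m → Fin n), (∀ t, i ≤ js t) ∧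
      Nonempty (P (k + 1) ≃ₗ[A] ((t : Fin m) → ↥(leftIdeal A (e (js t))))))
    -- … and all differentials radical maps (minimal resolution)
    (hrad : ∀ l, IsRadHom A (dP l))
    -- the degree `k = k' + 1 ≥ 1`
    (k' : ℕ)
    -- a chain map `g : P• → P•[k]`
    (g : ∀ m, P (k' + m + 1) →ₗ[A] P m)
    (hchain : ∀ m, (g m) ∘ₗ (dP (k' + m + 1)) =
      ((-1 : ℤ) ^ (k' + 1)) • ((dP m) ∘ₗ (g (m + 1)))) :
    -- conclusion: `g` is null-homotopic iff `g^{(k)} ∈ rad_A(P_k, P_0)`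
    (∃ h : ∀ m, P (k' + m) →ₗ[A] P m,
      ∀ m, g m = ((dP m) ∘ₗ (h (m + 1)) : P (k' + m + 1) →ₗ[A] P m) -
        ((-1 : ℤ) ^ k') • ((h m) ∘ₗ (dP (k' + m)))) ↔
      IsRadHom A (g 0) := by
  constructor
  · rintro ⟨h, hh⟩
    rw [hh 0]
    rintro _ ⟨x, rfl⟩
    exact Submodule.sub_mem _ ((hrad 0).comp_right (h 1) ⟨x, rfl⟩)
      (zsmul_mem ((hrad (k' + 0)).comp_left (h 0) ⟨x, rfl⟩) _)
  · intro hg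
    have := hproj 0
    have := hproj (k' + 0 + 1)
    obtain ⟨ψ, hψ⟩ := Module.projective_lifting_property (properU A e i).mkQ π
      (Submodule.mkQ_surjective _)
    obtain ⟨m, js, hjs, ⟨φ⟩⟩ := hPk (k' + 0)
    obtain ⟨u₀, hu₀⟩ := exists_comp_eq_of_range_le (dP 0) (g 0) <| by
      rintro _ ⟨x, rfl⟩
      refine (hex0 _).mp ?_
      rw [← hψ, LinearMap.comp_apply, Submodule.mkQ_apply, Submodule.Quotient.mk_eq_zero]
      refine ((hg.comp_left ψ).comp_right φ.symm.toLinearMap).range_le_properU hjs ⟨φ x, ?_⟩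
      simp
    exact exists_homotopy_of_factor P hproj dP hex k' g hchain u₀ hu₀

end
end

section
/- Let V = ⊕_{k ≥ −1} V_k be a ℤ-graded K-vector space concentrated in degrees ≥ −1, and for each r ≥ 1 let b_r : V^{⊗r} → V be a homogeneous K-linear map of degree 1 (the degree of a homogeneous tensor being the sum of the degrees of its factors) such that for every k ≥ 1 the A∞-relation Σ_{k = r+t+u, r,u ≥ 0, t ≥ 1} b_{r+1+u} ∘ (id^{⊗r} ⊗ b_t ⊗ id^{⊗u}) = 0 holds as a map V^{⊗k} → V. Let W = V_{−1} ⊕ V_0 ⊕ V_1 and define b'_r : W^{⊗r} → W on homogeneous tensors x by b'_r(x) = b_r(x) if the total degree of x is ≤ 0 (its value then lies in W) and b'_r(x) = 0 if the total degree of x is ≥ 1. Let ι : V_{−1} ⊕ V_0 → W be the inclusion. Then for every k ≥ 1, Σ_{k = r+t+u, r,u ≥ 0, t ≥ 1} b'_{r+1+u} ∘ (id^{⊗r} ⊗ b'_t ⊗ id^{⊗u}) ∘ ι^{⊗k} = 0. -/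
/-!
STATEMENT 6 (truncation of the `b`-operations, Proposition `mult tensor alg` (1) of the paper).

A ℤ-graded vector space is encoded as an ambient `K`-vector space `𝕍` together with an
internal direct sum decomposition `V : ℤ → Submodule K 𝕍`.  The operations
`b r : V^{⊗r} → V` are encoded as multilinear maps `𝕍^r → 𝕍` which are homogeneous of
degree 1 on homogeneous tuples.  The A∞-relation
`Σ_{k=r+t+u} b_{r+1+u} ∘ (id^{⊗r} ⊗ b_t ⊗ id^{⊗u}) = 0` is unpacked on homogeneous
elements, with the Koszul sign `(-1)^{Σ degrees of the factors to the left of b_t}`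
(`b_t` has odd degree, `id` degree 0).  Tuples are written ascendingly:
`x 0 = a_1, …, x (k-1) = a_k`, so `b_t` occupies the slots `u, …, u+t-1` and the
sign is `(-1)^{d(u+t) + ⋯ + d(k-1)}`.  `splice x u t mid` is the tuple obtained from `x`
by replacing the `t` slots starting at position `u` by the single entry `mid`.
The truncated operations `b'` are encoded by `btrunc`: on a homogeneous tuple of degrees
`d 0, …, d (r-1)`, it is `b_r` if the total degree is `≤ 0` and `0` otherwise.
-/

noncomputable section

/-- replace the `t` slots starting at position `u` by the single entry `mid` -/
def splice {α : Type*} (x : ℕ → α) (u t : ℕ) (mid : α) : ℕ → α :=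
  fun p => if p < u then x p else if p = u then mid else x (p + t - 1)

/-- the truncated operation `b'_r`, evaluated on a homogeneous tuple whose degrees are
prescribed by `d` -/
def btrunc {K 𝕍 : Type*} [Field K] [AddCommGroup 𝕍] [Module K 𝕍]
    (b : ∀ r : ℕ, MultilinearMap K (fun _ : Fin r => 𝕍) 𝕍)
    (r : ℕ) (d : ℕ → ℤ) (x : ℕ → 𝕍) : 𝕍 :=
  if (∑ p ∈ Finset.range r, d p) ≤ 0 then b r (fun s => x s) else 0

/-- Replacing a block by an entry of degree one more than the block's total degree raises the
total degree of the tuple by one. -/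
theorem sum_splice (d : ℕ → ℤ) {k u t : ℕ} (ht : 1 ≤ t) (hut : u + t ≤ k) :
    ∑ p ∈ Finset.range (k - t - u + 1 + u),
        splice d u t ((∑ s ∈ Finset.range t, d (u + s)) + 1) p =
      (∑ p ∈ Finset.range k, d p) + 1 := by
  obtain ⟨r, rfl⟩ := Nat.exists_eq_add_of_le hut
  have hlen : u + t + r - t - u + 1 + u = u + 1 + r := by omega
  have hleft : ∀ m : ℤ, ∑ p ∈ Finset.range u, splice d u t m p = ∑ p ∈ Finset.range u, d p :=
    fun m => Finset.sum_congr rfl fun p hp => if_pos (Finset.mem_range.1 hp)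
  have hmid : ∀ m : ℤ, splice d u t m u = m := fun m => by simp [splice]
  have hright : ∀ (m : ℤ) (p : ℕ), splice d u t m (u + 1 + p) = d (u + t + p) := fun m p => by
    have hp : u + 1 + p + t - 1 = u + t + p := by omega
    rw [splice, if_neg (by omega), if_neg (by omega), hp]
  rw [hlen, Finset.sum_range_add, Finset.sum_range_succ, hleft, hmid,
    Finset.sum_congr rfl fun p _ => hright _ p, Finset.sum_range_add _ (u + t) r,
    Finset.sum_range_add _ u t]
  ring

theorem stmt6 {K : Type*} [Field K]
    {𝕍 : Type*} [AddCommGroup 𝕍] [Module K 𝕍]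
    -- a ℤ-graded vector space `V`, concentrated in degrees `≥ -1`
    (V : ℤ → Submodule K 𝕍)
    (hV : DirectSum.IsInternal V)
    (hconc : ∀ k : ℤ, k < -1 → V k = ⊥)
    -- homogeneous operations `b_r` of degree 1
    (b : ∀ r : ℕ, MultilinearMap K (fun _ : Fin r => 𝕍) 𝕍)
    (hdeg : ∀ (r : ℕ) (d : ℕ → ℤ) (x : ℕ → 𝕍), (∀ p < r, x p ∈ V (d p)) →
      b r (fun s => x s) ∈ V ((∑ p ∈ Finset.range r, d p) + 1))
    -- the A∞-relations for `b`
    (hrel : ∀ k : ℕ, 1 ≤ k → ∀ (d : ℕ → ℤ) (x : ℕ → 𝕍), (∀ p < k, x p ∈ V (d p)) →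
      ∑ u ∈ Finset.range k, ∑ t ∈ Finset.Icc 1 (k - u),
        ((-1 : K) ^ (∑ p ∈ Finset.Ico (u + t) k, d p)) •
          b (k - t - u + 1 + u)
            (fun s => splice x u t (b t (fun s' => x (u + s'))) s) = 0) :
    -- conclusion: the truncated A∞-relations, precomposed with `ι^{⊗k}` where
    -- `ι : V_{-1} ⊕ V_0 → V_{-1} ⊕ V_0 ⊕ V_1` (inputs of degrees `≤ 0`)
    ∀ k : ℕ, 1 ≤ k → ∀ (d : ℕ → ℤ) (x : ℕ → 𝕍),
      (∀ p < k, d p ≤ 0) → (∀ p < k, x p ∈ V (d p)) →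
      ∑ u ∈ Finset.range k, ∑ t ∈ Finset.Icc 1 (k - u),
        ((-1 : K) ^ (∑ p ∈ Finset.Ico (u + t) k, d p)) •
          btrunc b (k - t - u + 1 + u)
            (splice d u t ((∑ s ∈ Finset.range t, d (u + s)) + 1))
            (splice x u t (btrunc b t (fun p => d (u + p)) (fun p => x (u + p)))) = 0 := by
  intro k hk d x hd hx
  have hbounds : ∀ u ∈ Finset.range k, ∀ t ∈ Finset.Icc 1 (k - u), 1 ≤ t ∧ u + t ≤ k := by
    intro u hu t ht
    rw [Finset.mem_range] at hu
    rw [Finset.mem_Icc] at ht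
    omega
  by_cases hneg : (∑ p ∈ Finset.range k, d p) + 1 ≤ 0
  · rw [← hrel k hk d x hx]
    refine Finset.sum_congr rfl fun u hu => Finset.sum_congr rfl fun t ht => ?_
    obtain ⟨ht1, hut⟩ := hbounds u hu t ht
    have hinner : ∑ p ∈ Finset.range t, d (u + p) ≤ 0 :=
      Finset.sum_nonpos fun p hp => hd _ (by rw [Finset.mem_range] at hp; omega)
    rw [btrunc, sum_splice d ht1 hut, if_pos hneg, btrunc, if_pos hinner]
  · refine Finset.sum_eq_zero fun u hu => Finset.sum_eq_zero fun t ht => ?_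
    obtain ⟨ht1, hut⟩ := hbounds u hu t ht
    rw [btrunc, sum_splice d ht1 hut, if_neg hneg, smul_zero]

end
end

section
/- Fix 1 ≤ i ≤ n, let e = e_{i+1} + ⋯ + e_n and A' = A/AeA. Then the properly standard A-module Δ̄(i) is annihilated by AeA, hence is an A'-module, and it coincides with the properly standard A'-module Δ̄_{A'}(i); moreover, for every k ≥ 0 the inflation along A ↠ A' induces an isomorphism Ext^k_{A'}(Δ̄(i),Δ̄(i)) ≅ Ext^k_A(Δ̄(i),Δ̄(i)) of K-vector spaces, and these isomorphisms are compatible with the Yoneda products, so that Ext^*_{A'}(Δ̄(i),Δ̄(i)) ≅ Ext^*_A(Δ̄(i),Δ̄(i)) as ℤ-graded K-algebras. -/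
/-!
STATEMENT 9 (Proposition "AA' iso" of the paper, Ext-algebra part, together with the
identification of the properly standard modules over `A` and `A' = A/AeA`).

`A` is a finite-dimensional basic `K`-algebra (`K` algebraically closed) with a complete
set of pairwise orthogonal primitive idempotents `e 0, …, e (n-1)`; `P(i) = Ae_i` is
`leftIdeal A (e i)`, `rad A` is the intersection of the maximal left ideals, and the
properly standard module is `Δ̄(i) = P(i)/U(i)` (`PStd`); `A` is assumed `Δ̄`-filtered.
The quotient `A' = A/AεA` with `ε = e_{i+1} + ⋯ + e_n` is encoded abstractly as a
`K`-algebra `A'` with a surjective ring homomorphism `ρ : A → A'`, compatible with the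
`K`-algebra structures, whose kernel is the two-sided ideal `AεA`; `ē j := ρ (e j)`.

The conclusions formalized are:
(a) `AεA` annihilates `Δ̄(i)`, so `Δ̄(i)` is an `A'`-module;
(b) `Δ̄(i)` coincides with the properly standard `A'`-module `Δ̄_{A'}(i) = PStd A' ē i`:
    there is an additive bijection, semilinear over `ρ`;
(c) `Ext^*_{A'}(Δ̄(i),Δ̄(i)) ≅ Ext^*_A(Δ̄(i),Δ̄(i))` as ℤ-graded `K`-algebras: for any
    chosen projective resolutions (over `A'` and over `A`), there is a family of `K`-linear
    bijections between the `Ext` groups in each degree (chain maps of the resolution modulo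
    null-homotopic ones) preserving the unit and compatible with the Yoneda products
    (`IsGradedExtAlgIso`).
-/

noncomputable section

def HasPStdFilt (A : Type u) [Ring A] {n : ℕ} (e : Fin n → A) (cond : Fin n → Prop)
    (M : Type u) [AddCommGroup M] [Module A M] : Prop :=
  ∃ (m : ℕ) (X : ℕ → Submodule A M), X 0 = ⊤ ∧ X m = ⊥ ∧ (∀ t, X (t + 1) ≤ X t) ∧
    ∀ t < m, ∃ j, cond j ∧ Nonempty
      ((↥(X t) ⧸ Submodule.comap (X t).subtype (X (t + 1))) ≃ₗ[A] PStd A e j)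

/-- `Hom_R(M,N)` is a left module over `E = End_R(M)ᵒᵖ` by precomposition -/
instance homEndOpModule (R : Type*) [Ring R] (M N : Type*) [AddCommGroup M] [Module R M]
    [AddCommGroup N] [Module R N] : Module (Module.End R M)ᵐᵒᵖ (M →ₗ[R] N) where
  smul e f := f ∘ₗ e.unop
  one_smul f := by ext x; rfl
  mul_smul a b f := by ext x; rfl
  smul_zero e := by ext x; rfl
  smul_add e f g := by ext x; rfl
  add_smul a b f := by
    show f ∘ₗ (a.unop + b.unop) = f ∘ₗ a.unop + f ∘ₗ b.unop
    ext x; simp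
  zero_smul f := by
    show f ∘ₗ (0 : Module.End R M) = 0
    ext x; simp

/-- `ε = e_{i+1} + ⋯ + e_n` -/
def sumLater (A : Type*) [Ring A] {n : ℕ} (e : Fin n → A) (i : Fin n) : A :=
  ∑ j ∈ Finset.univ.filter (fun j => i < j), e j

section ExtMachinery

variable {A : Type*} [Ring A]
variable (P : ℕ → Type*) [∀ l, AddCommGroup (P l)] [∀ l, Module A (P l)]

/-- transport along an equality of indices -/
def pcast {a b : ℕ} (h : a = b) : P a →ₗ[A] P b := by subst h; exact LinearMap.id

/-- the space `𝒜^k = Hom_A(P•,P•[k])` of degree-`k` families of maps, an element being the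
family of its components `g^{(k+m)} : P_{k+m} → P_m` -/
abbrev ExtDeg (A : Type*) [Ring A] (P : ℕ → Type*) [∀ l, AddCommGroup (P l)]
    [∀ l, Module A (P l)] (k : ℕ) := ∀ m : ℕ, P (k + m) →ₗ[A] P m

variable (dP : ∀ l, P (l + 1) →ₗ[A] P l)

/-- the chain-map condition `g^{(l)} ∘ ∂_{l+1} = (-1)^k ∂_{l-k+1} ∘ g^{(l+1)}` -/
def IsChainMap (k : ℕ) (g : ExtDeg A P k) : Prop :=
  ∀ m, (g m) ∘ₗ (dP (k + m)) = ((-1 : ℤ) ^ k) • ((dP m) ∘ₗ (g (m + 1)))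

/-- null-homotopy: for `k ≥ 1`, `g^{(l)} = ∂_{l-k+1} ∘ u^{(l)} - (-1)^(k-1) u^{(l-1)} ∘ ∂_l`
with `u^{(l)} : P_l → P_{l-k+1}` (encoded as `h m := u^{(m+k-1)}`); for `k = 0` the same with
`u^{(l)} : P_l → P_{l+1}` (encoded as `h m := u^{(m)}`) and `u^{(-1)} = 0`. -/
def IsNullMap : (k : ℕ) → ExtDeg A P k → Prop
  | 0, g => ∃ h : ∀ m, P m →ₗ[A] P (m + 1),
      (g 0 = dP 0 ∘ₗ h 0 ∘ₗ pcast P (by omega : (0 : ℕ) + 0 = 0)) ∧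
      ∀ m, g (m + 1) = (dP (m + 1) ∘ₗ h (m + 1) + h m ∘ₗ dP m) ∘ₗ
        pcast P (by omega : 0 + (m + 1) = m + 1)
  | (k' + 1), g => ∃ h : ∀ m, P (k' + m) →ₗ[A] P m,
      ∀ m, g m = (dP m ∘ₗ h (m + 1)) ∘ₗ pcast P (by omega : (k' + 1) + m = k' + (m + 1)) -
        ((-1 : ℤ) ^ k') • ((h m ∘ₗ dP (k' + m)) ∘ₗ
          pcast P (by omega : (k' + 1) + m = (k' + m) + 1))

variable (K : Type*) [Field K] [Algebra K A]
  [∀ l, Module K (P l)] [∀ l, IsScalarTower K A (P l)] [∀ l, SMulCommClass A K (P l)]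

/-- the `K`-subspace of chain maps (the set of chain maps is a subspace, so taking the span
does not change it) -/
def chainSub (k : ℕ) : Submodule K (ExtDeg A P k) :=
  Submodule.span K {g | IsChainMap P dP k g}

/-- the `K`-subspace of null-homotopic families -/
def nullSub (k : ℕ) : Submodule K (ExtDeg A P k) :=
  Submodule.span K {g | IsNullMap P dP k g}

/-- `Ext^k`: chain maps modulo null-homotopic chain maps, computed from the chosen
projective resolution `P•` -/
abbrev extQ (k : ℕ) := ↥(chainSub P dP K k) ⧸
  (Submodule.comap (chainSub P dP K k).subtype (nullSub P dP K k))

/-- the class in `Ext^k` of a chain map -/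
def extMk (k : ℕ) (g : ExtDeg A P k) (hg : IsChainMap P dP k g) : extQ P dP K k :=
  Submodule.Quotient.mk ⟨g, Submodule.subset_span hg⟩

/-- composition of degree-`j` and degree-`k` elements (the Yoneda product on `Ext`) -/
def extComp {j k : ℕ} (f : ExtDeg A P j) (g : ExtDeg A P k) : ExtDeg A P (j + k) :=
  fun m => (f m ∘ₗ g (j + m)) ∘ₗ pcast P (by omega : (j + k) + m = k + (j + m))

/-- the identity chain map, of degree `0` -/
def extId : ExtDeg A P 0 := fun m => pcast P (by omega : 0 + m = m)

end ExtMachinery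

/-- A family of `K`-linear bijections `Ext^k_A(M,M) ≅ Ext^k_B(N,N)` (computed from chosen
projective resolutions `P•` of `M` over `A` and `P'•` of `N` over `B`) is an isomorphism of
ℤ-graded `K`-algebras: it sends the identity to the identity and is compatible with the
Yoneda products (composition of chain maps). -/
def IsGradedExtAlgIso
    {A : Type*} [Ring A] (P : ℕ → Type*) [∀ l, AddCommGroup (P l)] [∀ l, Module A (P l)]
    (dP : ∀ l, P (l + 1) →ₗ[A] P l)
    {B : Type*} [Ring B] (P' : ℕ → Type*) [∀ l, AddCommGroup (P' l)] [∀ l, Module B (P' l)]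
    (dP' : ∀ l, P' (l + 1) →ₗ[B] P' l)
    (K : Type*) [Field K] [Algebra K A] [Algebra K B]
    [∀ l, Module K (P l)] [∀ l, IsScalarTower K A (P l)] [∀ l, SMulCommClass A K (P l)]
    [∀ l, Module K (P' l)] [∀ l, IsScalarTower K B (P' l)] [∀ l, SMulCommClass B K (P' l)]
    (φ : ∀ k, extQ P dP K k ≃ₗ[K] extQ P' dP' K k) : Prop :=
  (∀ (hid : IsChainMap P dP 0 (extId P)) (hid' : IsChainMap P' dP' 0 (extId P')),
      φ 0 (extMk P dP K 0 (extId P) hid) = extMk P' dP' K 0 (extId P') hid') ∧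
  (∀ (j k : ℕ) (x : ExtDeg A P j) (y : ExtDeg A P k)
      (hx : IsChainMap P dP j x) (hy : IsChainMap P dP k y)
      (hxy : IsChainMap P dP (j + k) (extComp P x y))
      (x' : ExtDeg B P' j) (y' : ExtDeg B P' k)
      (hx' : IsChainMap P' dP' j x') (hy' : IsChainMap P' dP' k y')
      (hxy' : IsChainMap P' dP' (j + k) (extComp P' x' y')),
      φ j (extMk P dP K j x hx) = extMk P' dP' K j x' hx' →
      φ k (extMk P dP K k y hy) = extMk P' dP' K k y' hy' →
      φ (j + k) (extMk P dP K (j + k) (extComp P x y) hxy) =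
        extMk P' dP' K (j + k) (extComp P' x' y') hxy')


section TraceResolved

/-- The submodule `AεX` of a module `X`. -/
def traceSub {A : Type*} [Ring A] (ε : A) (X : Type*) [AddCommGroup X] [Module A X] :
    Submodule A X :=
  Submodule.span A (Set.range fun x : X => ε • x)

variable {A : Type u} [Ring A] {ε : A}

theorem smul_mem_traceSub {X : Type*} [AddCommGroup X] [Module A X] (x : X) :
    ε • x ∈ traceSub ε X :=
  Submodule.subset_span ⟨x, rfl⟩

theorem traceSub_le {X : Type*} [AddCommGroup X] [Module A X] {S : Submodule A X} :
    traceSub ε X ≤ S ↔ ∀ x : X, ε • x ∈ S := by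
  rw [traceSub, Submodule.span_le, Set.range_subset_iff]
  rfl

theorem map_mem_traceSub {X Y : Type*} [AddCommGroup X] [Module A X] [AddCommGroup Y]
    [Module A Y] (f : X →ₗ[A] Y) {x : X} (hx : x ∈ traceSub ε X) : f x ∈ traceSub ε Y := by
  have : traceSub ε X ≤ (traceSub ε Y).comap f :=
    traceSub_le.2 fun x => by simpa using smul_mem_traceSub (f x)
  exact this hx

theorem traceSub_eq_top_of_surjective {X Y : Type*} [AddCommGroup X] [Module A X]
    [AddCommGroup Y] [Module A Y] (f : X →ₗ[A] Y) (hf : Function.Surjective f)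
    (hX : traceSub ε X = ⊤) : traceSub ε Y = ⊤ := by
  refine eq_top_iff.2 fun y _ => ?_
  obtain ⟨x, rfl⟩ := hf y
  exact map_mem_traceSub f (hX ▸ Submodule.mem_top)

theorem exists_mem_traceSub_map_eq {X Y : Type*} [AddCommGroup X] [Module A X]
    [AddCommGroup Y] [Module A Y] (f : X →ₗ[A] Y) (hf : Function.Surjective f) {y : Y}
    (hy : y ∈ traceSub ε Y) : ∃ x ∈ traceSub ε X, f x = y := by
  have : traceSub ε Y ≤ (traceSub ε X).map f := traceSub_le.2 fun y => by
    obtain ⟨x, rfl⟩ := hf y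
    exact ⟨ε • x, smul_mem_traceSub x, by simp⟩
  exact this hy

/-- `X` has a projective resolution whose first `n` terms `P`, as well as the `n`-th syzygy,
are generated by `εP`. -/
def IsTraceResolved (ε : A) : ℕ → ∀ (X : Type u) [AddCommGroup X] [Module A X], Prop
  | 0, X, _, _ => traceSub ε X = ⊤
  | n + 1, X, _, _ => ∃ (P : Type u) (_ : AddCommGroup P) (_ : Module A P) (p : P →ₗ[A] X),
      Module.Projective A P ∧ traceSub ε P = ⊤ ∧ Function.Surjective p ∧
        IsTraceResolved ε n (LinearMap.ker p)

theorem IsTraceResolved.traceSub_eq_top {n : ℕ} {X : Type u} [AddCommGroup X] [Module A X]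
    (h : IsTraceResolved ε n X) : traceSub ε X = ⊤ := by
  cases n with
  | zero => exact h
  | succ n =>
    obtain ⟨P, _, _, p, -, hP, hp, -⟩ := h
    exact traceSub_eq_top_of_surjective p hp hP

theorem isTraceResolved_of_subsingleton (n : ℕ) (X : Type u) [AddCommGroup X] [Module A X]
    [Subsingleton X] : IsTraceResolved ε n X := by
  induction n generalizing X with
  | zero => exact Subsingleton.elim _ _
  | succ n ih => exact ⟨X, _, _, LinearMap.id, inferInstance, Subsingleton.elim _ _,
      Function.surjective_id, ih _⟩

/-- Horseshoe lemma. -/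
theorem IsTraceResolved.of_exact {n : ℕ} {X Y Z : Type u} [AddCommGroup X] [Module A X]
    [AddCommGroup Y] [Module A Y] [AddCommGroup Z] [Module A Z] (f : X →ₗ[A] Y) (g : Y →ₗ[A] Z)
    (hf : Function.Injective f) (hg : Function.Surjective g) (hfg : Function.Exact f g)
    (hX : IsTraceResolved ε n X) (hZ : IsTraceResolved ε n Z) : IsTraceResolved ε n Y := by
  induction n generalizing X Y Z with
  | zero =>
    refine eq_top_iff.2 fun y _ => ?_
    obtain ⟨y', hy', h⟩ := exists_mem_traceSub_map_eq g hg (y := g y)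
      ((show traceSub ε Z = ⊤ from hZ) ▸ Submodule.mem_top)
    obtain ⟨x, hx⟩ := (hfg (y - y')).1 (by simp [h])
    have hx' : f x ∈ traceSub ε Y :=
      map_mem_traceSub f ((show traceSub ε X = ⊤ from hX) ▸ Submodule.mem_top)
    simpa [hx] using add_mem hx' hy'
  | succ n ih =>
    obtain ⟨P, _, _, a, hPp, hPt, ha, haK⟩ := hX
    obtain ⟨Q, _, _, b, hQp, hQt, hb, hbK⟩ := hZ
    obtain ⟨b', hb'⟩ := Module.projective_lifting_property g b hg
    replace hb' : ∀ q, g (b' q) = b q := fun q => LinearMap.congr_fun hb' q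
    have hgf : ∀ x, g (f x) = 0 := fun x => (hfg _).2 ⟨x, rfl⟩
    let c : P × Q →ₗ[A] Y := (f ∘ₗ a).coprod b'
    have hc : ∀ p q, c (p, q) = f (a p) + b' q := fun p q => by simp [c]
    refine ⟨P × Q, _, _, c, inferInstance, ?_, ?_, ?_⟩
    · refine eq_top_iff.2 fun x _ => ?_
      have h1 : x.1 ∈ traceSub ε P := hPt ▸ Submodule.mem_top
      have h2 : x.2 ∈ traceSub ε Q := hQt ▸ Submodule.mem_top
      simpa using add_mem (map_mem_traceSub (LinearMap.inl A P Q) h1)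
        (map_mem_traceSub (LinearMap.inr A P Q) h2)
    · intro y
      obtain ⟨q, hq⟩ := hb (g y)
      obtain ⟨x, hx⟩ := (hfg (y - b' q)).1 (by simp [hb', hq])
      obtain ⟨p, rfl⟩ := ha x
      exact ⟨(p, q), by simp [hc, hx]⟩
    · refine ih (X := LinearMap.ker a) (Z := LinearMap.ker b)
        (((LinearMap.inl A P Q).comp (LinearMap.ker a).subtype).codRestrict (LinearMap.ker c)
          fun p => by simp [hc])
        (((LinearMap.snd A P Q).comp (LinearMap.ker c).subtype).codRestrict (LinearMap.ker b)
          fun x => ?_) ?_ ?_ ?_ haK hbK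
      · have := congrArg g (LinearMap.mem_ker.1 x.2)
        obtain ⟨⟨p, q⟩, hx⟩ := x
        simpa [hc, hgf, hb'] using this
      · intro p p' h
        have := congrArg (fun z => z.1.1) h
        exact Subtype.ext this
      · rintro ⟨q, hq⟩
        obtain ⟨x, hx⟩ := (hfg (b' q)).1 (by rw [hb']; exact hq)
        obtain ⟨p, rfl⟩ := ha x
        exact ⟨⟨(-p, q), by simp [hc, hx]⟩, rfl⟩
      · rintro ⟨⟨p, q⟩, hx⟩
        constructor
        · intro h
          have hq : q = 0 := by simpa using congrArg Subtype.val h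
          subst hq
          refine ⟨⟨p, hf ?_⟩, rfl⟩
          simpa [hc] using hx
        · rintro ⟨p', h⟩
          have := congrArg (fun z => z.1.2) h
          exact Subtype.ext this.symm

theorem IsTraceResolved.of_linearEquiv {n : ℕ} {X Y : Type u} [AddCommGroup X] [Module A X]
    [AddCommGroup Y] [Module A Y] (f : X ≃ₗ[A] Y) (hX : IsTraceResolved ε n X) :
    IsTraceResolved ε n Y :=
  .of_exact (Z := PUnit) f.toLinearMap 0 f.injective (fun _ => ⟨0, rfl⟩)
    (fun y => ⟨fun _ => f.surjective y, fun _ => rfl⟩) hX (isTraceResolved_of_subsingleton n _)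

theorem IsTraceResolved.finsupp {n : ℕ} {X : Type u} [AddCommGroup X] [Module A X] (ι : Type u)
    (hX : IsTraceResolved ε n X) : IsTraceResolved ε n (ι →₀ X) := by
  have htop : ∀ {X : Type u} [AddCommGroup X] [Module A X], traceSub ε X = ⊤ →
      traceSub ε (ι →₀ X) = ⊤ := fun {X} _ _ h => by
    refine eq_top_iff.2 fun x _ => ?_
    induction x using Finsupp.induction_linear with
    | zero => exact zero_mem _
    | add x y hx hy => exact add_mem (hx trivial) (hy trivial)
    | single i x => exact map_mem_traceSub (Finsupp.lsingle i) (h ▸ Submodule.mem_top)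
  induction n generalizing X with
  | zero => exact htop hX
  | succ n ih =>
    obtain ⟨P, _, _, p, hPp, hPt, hp, hK⟩ := hX
    refine ⟨ι →₀ P, _, _, Finsupp.mapRange.linearMap p, ?_, htop hPt,
      Finsupp.mapRange_surjective _ (map_zero _) hp, ?_⟩
    · classical exact Module.Projective.of_equiv' (finsuppLequivDFinsupp A).symm
    · rw [Finsupp.ker_mapRange]
      let e : (ι →₀ LinearMap.ker p) →ₗ[A] (ι →₀ P) :=
        Finsupp.mapRange.linearMap (LinearMap.ker p).subtype
      have he : LinearMap.range e = Finsupp.submodule fun _ => LinearMap.ker p := by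
        rw [Finsupp.range_mapRange_linearMap _ (by simp)]
        simp
      rw [← he]
      exact (ih hK).of_linearEquiv (LinearEquiv.ofInjective e
        (Finsupp.mapRange_injective _ (map_zero _) Subtype.val_injective))

/-- `AεX` has projective resolutions by projectives `P = AεP`, of every length. -/
def HasResolvedTrace (ε : A) (X : Type u) [AddCommGroup X] [Module A X] : Prop :=
  ∀ n, IsTraceResolved ε n (traceSub ε X)

theorem mem_traceSub_of_exact (hε : IsIdempotentElem ε) {X Y Z : Type u} [AddCommGroup X]
    [Module A X] [AddCommGroup Y] [Module A Y] [AddCommGroup Z] [Module A Z] (f : X →ₗ[A] Y)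
    (g : Y →ₗ[A] Z) (hf : Function.Injective f) (hg : Function.Surjective g)
    (hfg : Function.Exact f g) (hZ : IsTraceResolved ε 1 (traceSub ε Z)) {x : X}
    (hx : f x ∈ traceSub ε Y) : x ∈ traceSub ε X := by
  obtain ⟨P, _, _, b, hPp, -, hb, hbK⟩ := hZ
  obtain ⟨h, hh⟩ := Module.projective_lifting_property g ((traceSub ε Z).subtype ∘ₗ b) hg
  replace hh : ∀ q, g (h q) = b q := fun q => LinearMap.congr_fun hh q
  have hK : ∀ k : LinearMap.ker b, h k ∈ (traceSub ε X).map f := by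
    have : traceSub ε (LinearMap.ker b) ≤
        ((traceSub ε X).map f).comap (h ∘ₗ (LinearMap.ker b).subtype) :=
      traceSub_le.2 fun k => by
        obtain ⟨l, hl⟩ := (hfg (h k)).1 (by rw [hh, LinearMap.mem_ker.1 k.2]; rfl)
        exact ⟨ε • l, smul_mem_traceSub l, by simp [hl]⟩
    intro k
    exact this ((show traceSub ε (LinearMap.ker b) = ⊤ from hbK) ▸ Submodule.mem_top)
  have hY : traceSub ε Y ≤ LinearMap.range h ⊔ (traceSub ε X).map f := traceSub_le.2 fun y => by
    obtain ⟨q, hq⟩ := hb ⟨ε • g y, smul_mem_traceSub _⟩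
    obtain ⟨l, hl⟩ := (hfg (ε • y - h q)).1 (by simp [hh, hq])
    refine Submodule.mem_sup.2 ⟨h (ε • q), ⟨_, rfl⟩, f (ε • l),
      ⟨_, smul_mem_traceSub l, rfl⟩, ?_⟩
    rw [map_smul, map_smul, hl, smul_sub, smul_smul, hε.eq]
    abel
  obtain ⟨_, ⟨q, rfl⟩, _, ⟨t, ht, rfl⟩, hqt⟩ := Submodule.mem_sup.1 (hY hx)
  have hq : b q = 0 := Subtype.ext <| by
    have hgf : ∀ x, g (f x) = 0 := fun x => (hfg _).2 ⟨x, rfl⟩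
    simpa [hgf, hh] using congrArg g hqt
  obtain ⟨t', ht', h'⟩ := hK ⟨q, hq⟩
  have h' : f t' = h q := h'
  rw [← h', ← map_add] at hqt
  exact hf hqt ▸ add_mem ht' ht

theorem HasResolvedTrace.of_exact (hε : IsIdempotentElem ε) {X Y Z : Type u} [AddCommGroup X]
    [Module A X] [AddCommGroup Y] [Module A Y] [AddCommGroup Z] [Module A Z] (f : X →ₗ[A] Y)
    (g : Y →ₗ[A] Z) (hf : Function.Injective f) (hg : Function.Surjective g)
    (hfg : Function.Exact f g) (hX : HasResolvedTrace ε X) (hZ : HasResolvedTrace ε Z) :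
    HasResolvedTrace ε Y := fun n => by
  refine .of_exact (f.restrict fun _ => map_mem_traceSub f)
    (g.restrict fun _ => map_mem_traceSub g) ?_ ?_ ?_ (hX n) (hZ n)
  · intro x y h
    exact Subtype.ext (hf (by simpa using congrArg Subtype.val h))
  · rintro ⟨z, hz⟩
    obtain ⟨y, hy, rfl⟩ := exists_mem_traceSub_map_eq g hg hz
    exact ⟨⟨y, hy⟩, rfl⟩
  · rintro ⟨y, hy⟩
    constructor
    · intro h
      obtain ⟨x, rfl⟩ := (hfg y).1 (by simpa using congrArg Subtype.val h)
      exact ⟨⟨x, mem_traceSub_of_exact hε f g hf hg hfg (hZ 1) hy⟩, rfl⟩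
    · rintro ⟨x, h⟩
      exact Subtype.ext ((hfg y).2 ⟨x, by simpa using congrArg Subtype.val h⟩)

theorem hasResolvedTrace_of_traceSub_eq_bot {X : Type u} [AddCommGroup X] [Module A X]
    (h : traceSub ε X = ⊥) : HasResolvedTrace ε X := fun n => by
  have : Subsingleton (traceSub ε X) := h ▸ inferInstance
  exact isTraceResolved_of_subsingleton n _

theorem hasResolvedTrace_of_forall {X : Type u} [AddCommGroup X] [Module A X]
    (h : ∀ n, IsTraceResolved ε n X) : HasResolvedTrace ε X := fun n => by
  have := (h 0).traceSub_eq_top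
  exact (h n).of_linearEquiv ((LinearEquiv.ofTop _ this).symm)

end TraceResolved


section ExtVanishing

open CategoryTheory

/-- `Ext^k_A(X, N)` vanishes. -/
def ExtVanishes (A : Type u) [Ring A] (X N : Type u) [AddCommGroup X] [Module A X]
    [AddCommGroup N] [Module A N] (k : ℕ) : Prop :=
  Subsingleton (Abelian.Ext (ModuleCat.of A X) (ModuleCat.of A N) k)

variable {A : Type u} [Ring A] {X Y Z N : Type u} [AddCommGroup X] [Module A X]
  [AddCommGroup Y] [Module A Y] [AddCommGroup Z] [Module A Z] [AddCommGroup N] [Module A N]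

theorem extVanishes_zero (h : ∀ f : X →ₗ[A] N, f = 0) : ExtVanishes A X N 0 :=
  have : Subsingleton (ModuleCat.of A X ⟶ ModuleCat.of A N) :=
    ⟨fun _ _ => ModuleCat.hom_ext ((h _).trans (h _).symm)⟩
  Abelian.Ext.homEquiv₀.subsingleton

theorem extVanishes_of_projective (k : ℕ) [Module.Projective A X] : ExtVanishes A X N (k + 1) :=
  Abelian.Ext.subsingleton_of_projective _ _ k

theorem ExtVanishes.of_retract {k : ℕ} (f : X →ₗ[A] Y) (g : Y →ₗ[A] X)
    (hgf : g ∘ₗ f = LinearMap.id)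
    (h : ExtVanishes A Y N k) : ExtVanishes A X N k := by
  have h : Subsingleton (Abelian.Ext (ModuleCat.of A Y) (ModuleCat.of A N) k) := h
  refine subsingleton_of_forall_eq 0 fun x => ?_
  have hx : (Abelian.Ext.mk₀ (ModuleCat.ofHom g)).comp x (zero_add k) = 0 := Subsingleton.elim _ _
  have := congrArg (fun y => (Abelian.Ext.mk₀ (ModuleCat.ofHom f)).comp y (zero_add k)) hx
  simpa [Abelian.Ext.mk₀_comp_mk₀_assoc, ← ModuleCat.ofHom_comp, hgf] using this

theorem shortExact_of_exact (f : X →ₗ[A] Y) (g : Y →ₗ[A] Z) (hf : Function.Injective f)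
    (hg : Function.Surjective g) (hfg : Function.Exact f g) :
    (ModuleCat.shortComplexOfCompEqZero f g hfg.linearMap_comp_eq_zero).ShortExact :=
  ModuleCat.shortComplex_shortExact _ hfg hf hg

theorem ExtVanishes.right {k : ℕ} (f : X →ₗ[A] Y) (g : Y →ₗ[A] Z) (hf : Function.Injective f)
    (hg : Function.Surjective g) (hfg : Function.Exact f g)
    (hX : ExtVanishes A X N k) (hY : ExtVanishes A Y N (k + 1)) :
    ExtVanishes A Z N (k + 1) := by
  have hX : Subsingleton (Abelian.Ext (ModuleCat.of A X) (ModuleCat.of A N) k) := hX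
  have hY : Subsingleton (Abelian.Ext (ModuleCat.of A Y) (ModuleCat.of A N) (k + 1)) := hY
  refine subsingleton_of_forall_eq 0 fun x => ?_
  obtain ⟨y, rfl⟩ := Abelian.Ext.contravariant_sequence_exact₃
    (shortExact_of_exact f g hf hg hfg) _ x (Subsingleton.elim _ _) (add_comm 1 k)
  rw [Subsingleton.elim y 0, Abelian.Ext.comp_zero]

theorem ExtVanishes.left {k : ℕ} (f : X →ₗ[A] Y) (g : Y →ₗ[A] Z) (hf : Function.Injective f)
    (hg : Function.Surjective g) (hfg : Function.Exact f g)
    (hY : ExtVanishes A Y N k) (hZ : ExtVanishes A Z N (k + 1)) :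
    ExtVanishes A X N k := by
  have hY : Subsingleton (Abelian.Ext (ModuleCat.of A Y) (ModuleCat.of A N) k) := hY
  have hZ : Subsingleton (Abelian.Ext (ModuleCat.of A Z) (ModuleCat.of A N) (k + 1)) := hZ
  refine subsingleton_of_forall_eq 0 fun x => ?_
  obtain ⟨y, rfl⟩ := Abelian.Ext.contravariant_sequence_exact₁
    (shortExact_of_exact f g hf hg hfg) _ x (add_comm 1 k) (Subsingleton.elim _ _)
  rw [Subsingleton.elim y 0, Abelian.Ext.comp_zero]

theorem ExtVanishes.exists_extension (f : X →ₗ[A] Y) (g : Y →ₗ[A] Z)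
    (hf : Function.Injective f) (hg : Function.Surjective g) (hfg : Function.Exact f g)
    (hZ : ExtVanishes A Z N 1) (u : X →ₗ[A] N) :
    ∃ v : Y →ₗ[A] N, v ∘ₗ f = u := by
  have hZ : Subsingleton (Abelian.Ext (ModuleCat.of A Z) (ModuleCat.of A N) 1) := hZ
  obtain ⟨y, hy⟩ := Abelian.Ext.contravariant_sequence_exact₁
    (shortExact_of_exact f g hf hg hfg) (ModuleCat.of A N)
    (Abelian.Ext.mk₀ (ModuleCat.ofHom u)) (add_zero 1) (Subsingleton.elim _ _)
  obtain ⟨v, rfl⟩ := (Abelian.Ext.mk₀_bijective _ _).2 y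
  refine ⟨v.hom, ?_⟩
  rw [Abelian.Ext.mk₀_comp_mk₀] at hy
  exact congrArg ModuleCat.Hom.hom ((Abelian.Ext.mk₀_bijective _ _).1 hy)

end ExtVanishing


section ExtOfResolvedTrace

variable {A : Type u} [Ring A]

theorem LinearMap.eq_zero_of_traceSub_eq_top {ε : A} {X N : Type*} [AddCommGroup X] [Module A X]
    [AddCommGroup N] [Module A N] (hN : ∀ x : N, ε • x = 0) (hX : traceSub ε X = ⊤)
    (f : X →ₗ[A] N) : f = 0 := by
  have : traceSub ε X ≤ LinearMap.ker f := traceSub_le.2 fun x => by simp [hN]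
  rwa [hX, top_le_iff, LinearMap.ker_eq_top] at this

theorem IsTraceResolved.extVanishes {ε : A} {n k : ℕ} (hk : k ≤ n) {X N : Type u}
    [AddCommGroup X] [Module A X] [AddCommGroup N] [Module A N] (hN : ∀ x : N, ε • x = 0)
    (hX : IsTraceResolved ε n X) : ExtVanishes A X N k := by
  induction n generalizing X k with
  | zero =>
    obtain rfl : k = 0 := by omega
    exact extVanishes_zero (LinearMap.eq_zero_of_traceSub_eq_top hN hX)
  | succ n ih =>
    cases k with
    | zero => exact extVanishes_zero (LinearMap.eq_zero_of_traceSub_eq_top hN hX.traceSub_eq_top)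
    | succ k =>
      obtain ⟨P, _, _, p, hPp, -, hp, hK⟩ := hX
      exact .right (LinearMap.ker p).subtype p Subtype.val_injective hp
        (LinearMap.exact_subtype_ker_map p) (ih (by omega) hK) (extVanishes_of_projective k)

/-- Projective modules over `A/AεA` are acyclic for `Hom_A(-, N)` if `εN = 0` and `AεA` has
resolutions by projectives `P = AεP`. -/
theorem HasResolvedTrace.extVanishes_of_projective_quotient {ε : A} (hA : HasResolvedTrace ε A)
    {A' : Type u} [Ring A'] (ρ : A →+* A') (hρsurj : Function.Surjective ρ)
    (hρker : ∀ a, ρ a = 0 ↔ a ∈ traceSub ε A) {X N : Type u} [AddCommGroup X] [Module A' X]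
    [Module.Projective A' X] [Module A X] (hX : ∀ (a : A) (x : X), a • x = ρ a • x)
    [AddCommGroup N] [Module A N] (hN : ∀ x : N, ε • x = 0) (k : ℕ) :
    ExtVanishes A X N (k + 1) := by
  let _ : Module A A' := Module.compHom A' ρ
  have hsmul : ∀ (a : A) (b : A'), a • b = ρ a * b := fun _ _ => rfl
  let ρl : A →ₗ[A] A' :=
    { toFun := ρ, map_add' := map_add ρ, map_smul' := fun a b => by simp [hsmul] }
  have hexact : Function.Exact (traceSub ε A).subtype ρl := fun a => by
    rw [show ρl a = 0 ↔ a ∈ traceSub ε A from hρker a]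
    simp
  have hfree : ExtVanishes A (X →₀ A') N (k + 1) :=
    .right (Finsupp.mapRange.linearMap (traceSub ε A).subtype) (Finsupp.mapRange.linearMap ρl)
      (Finsupp.mapRange_injective _ (map_zero _) Subtype.val_injective)
      (Finsupp.mapRange_surjective _ (map_zero _) hρsurj)
      (LinearMap.exact_iff.2 <| by
        rw [Finsupp.ker_mapRange, Finsupp.range_mapRange_linearMap _ (by simp),
          LinearMap.exact_iff.1 hexact])
      (((hA k).finsupp X).extVanishes le_rfl hN) (extVanishes_of_projective k)
  obtain ⟨s, hs⟩ := Module.projective_def'.1 ‹Module.Projective A' X›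
  have hsmul' : ∀ (a : A) (z : X →₀ A'), a • z = ρ a • z := fun a z => by ext; rfl
  exact hfree.of_retract
    ⟨⟨s, map_add s⟩, fun a x => by simp [hX, hsmul']⟩
    ⟨⟨Finsupp.linearCombination A' id, map_add _⟩, fun a x => by simp [hX, hsmul']⟩
    (LinearMap.ext fun x => LinearMap.congr_fun hs x)

/-- `Hom_A(-, N)` is exact on bounded below exact complexes of acyclic modules. -/
theorem exists_eq_comp_of_exact {C : ℕ → Type u} [∀ l, AddCommGroup (C l)] [∀ l, Module A (C l)]
    (d : ∀ l, C (l + 1) →ₗ[A] C l) (h0 : Function.Surjective (d 0))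
    (hd : ∀ l, Function.Exact (d (l + 1)) (d l)) {N : Type u} [AddCommGroup N] [Module A N]
    (hN : ∀ l k, ExtVanishes A (C l) N (k + 1)) (l : ℕ) (u : C (l + 1) →ₗ[A] N)
    (hu : u ∘ₗ d (l + 1) = 0) : ∃ w : C l →ₗ[A] N, w ∘ₗ d l = u := by
  have hle : ∀ l, LinearMap.range (d (l + 1)) ≤ LinearMap.ker (d l) := fun l =>
    (LinearMap.exact_iff.1 (hd l)).ge
  let ι : ∀ l, (C (l + 1) ⧸ LinearMap.range (d (l + 1))) →ₗ[A] C l := fun l =>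
    (LinearMap.range (d (l + 1))).liftQ (d l) (hle l)
  have hι : ∀ l, Function.Injective (ι l) := fun l => by
    rw [← LinearMap.ker_eq_bot]
    exact Submodule.ker_liftQ_eq_bot _ _ _ (LinearMap.exact_iff.1 (hd l)).le
  have hιr : ∀ l, Function.Exact (ι l) (LinearMap.range (d l)).mkQ := fun l => by
    rw [LinearMap.exact_iff, Submodule.ker_mkQ, Submodule.range_liftQ]
  have hQ : ∀ l k : ℕ, ExtVanishes A (C l ⧸ LinearMap.range (d l)) N (k + 1) := by
    intro l
    induction l with
    | zero =>
      have : Subsingleton (C 0 ⧸ LinearMap.range (d 0)) :=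
        Submodule.Quotient.subsingleton_iff.2 (LinearMap.range_eq_top.2 h0)
      exact fun k => extVanishes_of_projective k
    | succ l ih =>
      exact fun k => .left (ι l) _ (hι l) (Submodule.mkQ_surjective _) (hιr l)
        (hN l k) (ih (k + 1))
  obtain ⟨w, hw⟩ := (hQ l 0).exists_extension (ι l) _ (hι l) (Submodule.mkQ_surjective _) (hιr l)
    ((LinearMap.range (d (l + 1))).liftQ u (LinearMap.range_le_ker_iff.2 hu))
  refine ⟨w, LinearMap.ext fun x => ?_⟩
  simpa [ι] using LinearMap.congr_fun hw (Submodule.Quotient.mk x)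

end ExtOfResolvedTrace


section Idempotents

variable {A : Type*} [Ring A]

theorem jacRad_eq : jacRad A = Ring.jacobson A := (Ring.jacobson_eq_sInf_isMaximal A).symm

instance : (jacRad A).IsTwoSided := by
  rw [jacRad_eq]
  infer_instance

theorem exists_mul_one_add_eq_one {r : A} (hr : r ∈ jacRad A) : ∃ s, s * (1 + r) = 1 := by
  by_contra! h
  obtain ⟨I, hI, hle⟩ := Ideal.exists_le_maximal (Ideal.span {1 + r}) fun htop => by
    obtain ⟨s, hs⟩ := Ideal.mem_span_singleton'.1 ((Ideal.eq_top_iff_one _).1 htop)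
    exact h s hs
  have hrI : r ∈ I := (sInf_le (show I ∈ {I : Ideal A | I.IsMaximal} from hI) : jacRad A ≤ I) hr
  refine hI.ne_top ((Ideal.eq_top_iff_one I).2 ?_)
  simpa using sub_mem (hle (Ideal.mem_span_singleton_self (1 + r))) hrI

theorem mem_jacRad_of_forall {b : A} (h : ∀ c, ∃ s, s * (1 + c * b) = 1) : b ∈ jacRad A := by
  refine Submodule.mem_sInf.2 fun (I : Ideal A) (hI : I.IsMaximal) => ?_
  by_contra hb
  have htop : I ⊔ Ideal.span {b} = ⊤ := hI.1.2 _ <| lt_of_le_of_ne le_sup_left fun heq =>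
    hb (heq ▸ Ideal.mem_sup_right (Ideal.mem_span_singleton_self b))
  obtain ⟨y, hy, z, hz, hyz⟩ := Submodule.mem_sup.1 ((Ideal.eq_top_iff_one _).1 htop)
  obtain ⟨c, rfl⟩ := Ideal.mem_span_singleton'.1 hz
  obtain ⟨s, hs⟩ := h (-c)
  refine hI.ne_top ((Ideal.eq_top_iff_one I).2 (hs ▸ I.mul_mem_left s ?_))
  rwa [← hyz, neg_mul, add_neg_cancel_right]

theorem eq_zero_of_isIdempotentElem_of_mem_jacRad {f : A} (hf : IsIdempotentElem f)
    (hJ : f ∈ jacRad A) : f = 0 := by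
  obtain ⟨s, hs⟩ := exists_mul_one_add_eq_one (neg_mem hJ)
  rw [← one_mul f, ← hs, mul_assoc, add_mul, neg_mul, hf.eq, one_mul, add_neg_cancel, mul_zero]

theorem map_mem_jacRad {B : Type*} [Ring B] {ρ : A →+* B} (hρ : Function.Surjective ρ) {r : A}
    (hr : r ∈ jacRad A) : ρ r ∈ jacRad B := by
  refine Submodule.mem_sInf.2 fun (I : Ideal B) (hI : I.IsMaximal) => ?_
  have : (I.comap ρ).IsMaximal := Ideal.comap_isMaximal_of_surjective ρ hρ
  exact (sInf_le (show I.comap ρ ∈ {I : Ideal A | I.IsMaximal} from this) :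
    jacRad A ≤ I.comap ρ) hr

theorem mem_leftIdeal_iff {f y : A} (hf : IsIdempotentElem f) :
    y ∈ leftIdeal A f ↔ y * f = y := by
  constructor
  · rintro ⟨x, rfl⟩
    simp [mulRightLin, mul_assoc, hf.eq]
  · exact fun h => ⟨y, h⟩

theorem mul_mem_leftIdeal (x f : A) : x * f ∈ leftIdeal A f := ⟨x, rfl⟩

/-- Right multiplication by `f`, as a map `A → Af`. -/
def toLeftIdeal (f : A) : A →ₗ[A] leftIdeal A f := (mulRightLin A f).rangeRestrict

/-- The generator `f` of `Af`. -/
def leftIdealGen (f : A) : leftIdeal A f := ⟨f, 1, one_mul f⟩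

theorem smul_leftIdealGen {f : A} (hf : IsIdempotentElem f) (x : leftIdeal A f) :
    x.1 • leftIdealGen f = x :=
  Subtype.ext ((mem_leftIdeal_iff hf).1 x.2)

theorem leftIdeal_projective {f : A} (hf : IsIdempotentElem f) :
    Module.Projective A (leftIdeal A f) :=
  .of_split (leftIdeal A f).subtype (toLeftIdeal f) <| LinearMap.ext fun x =>
    Subtype.ext ((mem_leftIdeal_iff hf).1 x.2)

theorem val_mem_jacRad_of_mem_radM {f : A} {x : leftIdeal A f}
    (hx : x ∈ radM A (leftIdeal A f)) : x.1 ∈ jacRad A := by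
  have : radM A (leftIdeal A f) ≤ Submodule.comap (leftIdeal A f).subtype (jacRad A) := by
    refine Submodule.span_le.2 ?_
    rintro _ ⟨r, hr, m, rfl⟩
    exact Ideal.mul_mem_right _ _ hr
  exact this hx

theorem properU_eq_span {n : ℕ} {e : Fin n → A} (he : ∀ j, IsIdempotentElem (e j)) (i : Fin n) :
    properU A e i = Submodule.span A {x | ∃ j, i ≤ j ∧ x.1 ∈ jacRad A ∧ e j * x.1 = x.1} := by
  refine le_antisymm (iSup₂_le fun j hij => iSup₂_le fun φ hφ => ?_)
    (Submodule.span_le.2 ?_)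
  · rintro _ ⟨x, rfl⟩
    rw [← smul_leftIdealGen (he j) x, map_smul]
    refine Submodule.smul_mem _ _ (Submodule.subset_span ⟨j, hij,
      val_mem_jacRad_of_mem_radM (hφ ⟨_, rfl⟩), ?_⟩)
    have : e j • leftIdealGen (e j) = leftIdealGen (e j) :=
      smul_leftIdealGen (he j) (leftIdealGen (e j))
    exact congrArg Subtype.val ((map_smul φ (e j) (leftIdealGen (e j))).symm.trans
      (congrArg φ this))
  · rintro x ⟨j, hij, hx, hjx⟩
    let φ : leftIdeal A (e j) →ₗ[A] leftIdeal A (e i) :=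
      LinearMap.toSpanSingleton A _ x ∘ₗ (leftIdeal A (e j)).subtype
    have hφ : IsRadHom A φ := by
      rintro _ ⟨y, rfl⟩
      have : φ y = y.1 • x.1 • leftIdealGen (e i) := by rw [smul_leftIdealGen (he i)]; rfl
      rw [this]
      exact Submodule.smul_mem _ _ (Submodule.subset_span ⟨_, hx, _, rfl⟩)
    have hmem : x ∈ LinearMap.range φ := ⟨leftIdealGen (e j), Subtype.ext hjx⟩
    exact (le_iSup₂_of_le j hij (le_iSup₂_of_le φ hφ le_rfl) :
      LinearMap.range φ ≤ properU A e i) hmem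

theorem val_mem_jacRad_of_mem_properU {n : ℕ} {e : Fin n → A}
    (he : ∀ j, IsIdempotentElem (e j)) {i : Fin n} {x : leftIdeal A (e i)}
    (hx : x ∈ properU A e i) : x.1 ∈ jacRad A := by
  rw [properU_eq_span he] at hx
  have : Submodule.span A {x : leftIdeal A (e i) | ∃ j, i ≤ j ∧ x.1 ∈ jacRad A ∧ e j * x.1 = x.1} ≤
      Submodule.comap (leftIdeal A (e i)).subtype (jacRad A) :=
    Submodule.span_le.2 fun x ⟨_, _, hx, _⟩ => hx
  exact this hx

/-- Fitting's lemma in the corner ring `fAf` of a primitive idempotent `f`. -/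
theorem IsPrimitiveIdem.isNilpotent_or_exists_mul_eq (K : Type*) [Field K] [Algebra K A]
    [FiniteDimensional K A] {f y : A} (hf : IsPrimitiveIdem A f) (hfy : f * y = y)
    (hyf : y * f = y) : IsNilpotent y ∨ ∃ c, c * y = f := by
  let T : Module.End K A := LinearMap.mulRight K y
  obtain ⟨m, hm, hm1⟩ :=
    (T.eventually_isCompl_ker_pow_range_pow.and (Filter.eventually_ge_atTop 1)).exists
  have hT : ∀ x, (T ^ m) x = x * y ^ m := fun x => by simp [T, LinearMap.pow_mulRight]
  obtain ⟨m, rfl⟩ : ∃ k, m = k + 1 := ⟨m - 1, by omega⟩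
  obtain ⟨p, hp, q, hq, hpq⟩ := Submodule.mem_sup.1
    (hm.sup_eq_top ▸ Submodule.mem_top : f ∈ (T ^ (m + 1)).ker ⊔ (T ^ (m + 1)).range)
  have hker : ∀ x, x ∈ (T ^ (m + 1)).ker ↔ x * y ^ (m + 1) = 0 := fun x => by
    rw [LinearMap.mem_ker, hT]
  have hrange : ∀ x, x ∈ (T ^ (m + 1)).range ↔ ∃ a, a * y ^ (m + 1) = x := fun x =>
    exists_congr fun a => by rw [hT]
  have hfm : f * y ^ (m + 1) = y ^ (m + 1) := by rw [pow_succ', ← mul_assoc, hfy]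
  have hmf : y ^ (m + 1) * f = y ^ (m + 1) := by rw [pow_succ, mul_assoc, hyf]
  have huniq : ∀ a b c d : A, a * y ^ (m + 1) = 0 → c * y ^ (m + 1) = 0 →
      (∃ u, u * y ^ (m + 1) = b) → (∃ u, u * y ^ (m + 1) = d) → a + b = c + d →
      a = c ∧ b = d := by
    intro a b c d ha hc ⟨u, hu⟩ ⟨v, hv⟩ h
    have h1 : a - c ∈ (T ^ (m + 1)).ker := (hker _).2 (by rw [sub_mul, ha, hc, sub_zero])
    have h2 : a - c ∈ (T ^ (m + 1)).range := (hrange _).2 ⟨v - u, by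
      rw [sub_mul, hu, hv, sub_eq_sub_iff_add_eq_add, add_comm d, ← h, add_comm]⟩
    have h3 : a = c := sub_eq_zero.1 (Submodule.disjoint_def.1 hm.disjoint _ h1 h2)
    exact ⟨h3, by rwa [h3, add_right_inj] at h⟩
  have hp' := (hker p).1 hp
  obtain ⟨a, ha⟩ := (hrange q).1 hq
  have hff : f * f = f := hf.1
  have hleft : ∀ x : A, x * p * y ^ (m + 1) = 0 := fun x => by rw [mul_assoc, hp', mul_zero]
  have hright : ∀ x : A, ∃ u, u * y ^ (m + 1) = x * q := fun x => ⟨x * a, by rw [mul_assoc, ha]⟩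
  obtain ⟨hpf, hqf⟩ := huniq (p * f) (q * f) p q (by rw [mul_assoc, hfm, hp']) hp'
    ⟨a, by rw [← ha, mul_assoc, hmf]⟩ ⟨a, ha⟩ (by rw [← add_mul, hpq, hff])
  obtain ⟨hpp, hpq0⟩ := huniq (p * p) (p * q) p 0 (hleft p) hp' (hright p) ⟨0, zero_mul _⟩
    (by rw [← mul_add, hpq, hpf, add_zero])
  obtain ⟨hqp, hqq⟩ := huniq (q * p) (q * q) 0 q (hleft q) (zero_mul _) (hright q) ⟨a, ha⟩
    (by rw [← mul_add, hpq, hqf, zero_add])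
  rcases hf.2.2 p q hpp hqq hpq0 hqp hpq.symm with rfl | rfl
  · exact .inr ⟨a * y ^ m, by rw [mul_assoc, ← pow_succ, ha, ← hpq, zero_add]⟩
  · rw [add_zero] at hpq
    exact .inl ⟨m + 1, by rw [← hfm, ← hpq, hp']⟩

theorem IsPrimitiveIdem.mem_jacRad (K : Type*) [Field K] [Algebra K A] [FiniteDimensional K A]
    {f b : A} (hf : IsPrimitiveIdem A f) (hb : b * f = b) (h : ∀ a, a * b ≠ f) :
    b ∈ jacRad A := by
  refine mem_jacRad_of_forall fun c => ?_
  have hff : f * f = f := hf.1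
  rcases hf.isNilpotent_or_exists_mul_eq K (y := f * (c * b)) (by rw [← mul_assoc, hff])
    (by rw [mul_assoc, mul_assoc, hb]) with ⟨k, hk⟩ | ⟨a, ha⟩
  · have hpow : ∀ k : ℕ, (c * b) ^ (k + 1) = c * b * (f * (c * b)) ^ k := fun k => by
      induction k with
      | zero => simp
      | succ k ih =>
        have hf : (c * b) ^ (k + 1) * f = (c * b) ^ (k + 1) := by
          rw [pow_succ, mul_assoc, mul_assoc, hb]
        rw [pow_succ, ← hf, ih, pow_succ]
        simp only [mul_assoc]
    have hnil : IsNilpotent (c * b) := ⟨k + 1, by rw [hpow, hk, mul_zero]⟩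
    obtain ⟨u, hu⟩ := hnil.isUnit_one_add
    exact ⟨_, hu ▸ u.inv_mul⟩
  · exact absurd ((mul_assoc _ _ _).trans ((mul_assoc a f (c * b)).trans ha)) (h (a * f * c))

theorem IsPrimitiveIdem.nonempty_linearEquiv {f g a b : A} (hf : IsPrimitiveIdem A f)
    (hg : IsPrimitiveIdem A g) (hgb : g * b = b) (hbf : b * f = b) (hab : a * b = f) :
    Nonempty (leftIdeal A f ≃ₗ[A] leftIdeal A g) := by
  have hff : f * f = f := hf.1
  have hgg : g * g = g := hg.1
  obtain ⟨a, hab, hag, hfa⟩ : ∃ a, a * b = f ∧ a * g = a ∧ f * a = a :=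
    ⟨f * a * g, by rw [mul_assoc, hgb, mul_assoc, hab, hff], by rw [mul_assoc, hgg],
      by rw [← mul_assoc, ← mul_assoc, hff]⟩
  have hidem : IsIdempotentElem (b * a) := by
    rw [IsIdempotentElem, mul_assoc, ← mul_assoc a, hab, hfa]
  have hgp : g * (b * a) = b * a := by rw [← mul_assoc, hgb]
  have hpg : b * a * g = b * a := by rw [mul_assoc, hag]
  have hba : b * a = g := by
    rcases hg.2.2 (b * a) (g - b * a) hidem
      (by simp [IsIdempotentElem, mul_sub, sub_mul, hgg, hgp, hpg, hidem.eq])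
      (by rw [mul_sub, hpg, hidem.eq, sub_self]) (by rw [sub_mul, hgp, hidem.eq, sub_self])
      (by simp) with h | h
    · refine absurd ?_ hf.2.1
      rw [← hff, ← hab, mul_assoc, ← mul_assoc b, h, zero_mul, mul_zero]
    · exact (sub_eq_zero.1 h).symm
  refine ⟨.ofLinearMap ((mulRightLin A a).restrict fun x _ => ?_)
    ((mulRightLin A b).restrict fun x _ => ?_) ?_ ?_⟩
  · exact ⟨x * a, by simp [mulRightLin, mul_assoc, hag]⟩
  · exact ⟨x * b, by simp [mulRightLin, mul_assoc, hbf]⟩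
  · refine LinearMap.ext fun x => Subtype.ext ?_
    have := (mem_leftIdeal_iff hg.1).1 x.2
    simpa [mulRightLin, mul_assoc, hba] using this
  · refine LinearMap.ext fun x => Subtype.ext ?_
    have := (mem_leftIdeal_iff hf.1).1 x.2
    simpa [mulRightLin, mul_assoc, hab] using this

end Idempotents


section Filtration

/-- Induction along a filtration whose factors are properly standard modules. -/
theorem filtration_induction {A : Type u} [Ring A]
    {Ψ : ∀ (X : Type u) [AddCommGroup X] [Module A X], Prop}
    (hsub : ∀ (X : Type u) [AddCommGroup X] [Module A X] [Subsingleton X], Ψ X)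
    (hext : ∀ (X Y Z : Type u) [AddCommGroup X] [Module A X] [AddCommGroup Y] [Module A Y]
      [AddCommGroup Z] [Module A Z] (f : X →ₗ[A] Y) (g : Y →ₗ[A] Z), Function.Injective f →
      Function.Surjective g → Function.Exact f g → Ψ X → Ψ Z → Ψ Y)
    {M : Type u} [AddCommGroup M] [Module A M] {X : ℕ → Submodule A M} {m s : ℕ}
    (hm : X m = ⊥) (hle : ∀ t, X (t + 1) ≤ X t) (hs : s ≤ m) {n : ℕ} {e : Fin n → A}
    {cond : Fin n → Prop} (hΨ : ∀ j, cond j → Ψ (PStd A e j))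
    (hX : ∀ t, s ≤ t → t < m → ∃ j, cond j ∧ Nonempty
      ((↥(X t) ⧸ Submodule.comap (X t).subtype (X (t + 1))) ≃ₗ[A] PStd A e j)) : Ψ (X s) := by
  have key : ∀ d t, s ≤ t → t + d = m → Ψ (X t) := by
    intro d
    induction d with
    | zero =>
      rintro t - rfl
      have : Subsingleton (X t) := hm ▸ inferInstance
      exact hsub _
    | succ d ih =>
      intro t hst htd
      obtain ⟨j, hj, ⟨α⟩⟩ := hX t hst (by omega)
      refine hext _ _ _ (Submodule.inclusion (hle t))
        (α.toLinearMap ∘ₗ (Submodule.comap (X t).subtype (X (t + 1))).mkQ)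
        (Submodule.inclusion_injective _) (α.surjective.comp (Submodule.mkQ_surjective _))
        ?_ (ih (t + 1) (by omega) (by omega)) (hΨ j hj)
      intro x
      simp only [LinearMap.comp_apply, LinearEquiv.coe_coe, LinearEquiv.map_eq_zero_iff,
        Submodule.mkQ_apply, Submodule.Quotient.mk_eq_zero, Submodule.mem_comap,
        Submodule.subtype_apply, Set.mem_range]
      exact ⟨fun h => ⟨⟨x, h⟩, rfl⟩, by rintro ⟨y, rfl⟩; exact y.2⟩
  exact key (m - s) s le_rfl (by omega)

/-- A complete system of orthogonal primitive idempotents of a basic algebra. -/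
structure IsBasicSystem {A : Type*} [Ring A] {n : ℕ} (e : Fin n → A) : Prop where
  prim : ∀ i, IsPrimitiveIdem A (e i)
  orth : ∀ i j, i ≠ j → e i * e j = 0
  complete : ∑ i, e i = 1
  basic : ∀ i j, i ≠ j → ¬ Nonempty (leftIdeal A (e i) ≃ₗ[A] leftIdeal A (e j))

namespace IsBasicSystem

variable {A : Type u} [Ring A] {n : ℕ} {e : Fin n → A} (h : IsBasicSystem e)
include h

theorem idem (i : Fin n) : IsIdempotentElem (e i) := (h.prim i).1

theorem sumLater_mul_of_lt {i j : Fin n} (hij : i < j) : sumLater A e i * e j = e j := by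
  rw [sumLater, Finset.sum_mul, Finset.sum_eq_single_of_mem j (by simpa using hij)
    (fun b _ hb => h.orth b j hb), (h.idem j).eq]

theorem isIdempotentElem_sumLater (i : Fin n) : IsIdempotentElem (sumLater A e i) := by
  rw [IsIdempotentElem]
  nth_rw 2 [sumLater]
  rw [Finset.mul_sum]
  exact Finset.sum_congr rfl fun j hj => h.sumLater_mul_of_lt (by simpa using hj)

theorem map_sumLater {B : Type*} [Ring B] {ρ : A →+* B} {i j : Fin n}
    (hρ : ρ (sumLater A e i) = 0) (hij : i < j) : ρ (e j) = 0 := by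
  rw [← h.sumLater_mul_of_lt hij, map_mul, hρ, zero_mul]

theorem eq_of_mul_eq {i j : Fin n} {a b : A} (hjb : e j * b = b) (hbi : b * e i = b)
    (hab : a * b = e i) : i = j := by
  by_contra hij
  exact h.basic i j hij ((h.prim i).nonempty_linearEquiv (h.prim j) hjb hbi hab)

theorem eq_of_surjective {i j : Fin n} (g : leftIdeal A (e j) →ₗ[A] PStd A e i)
    (hg : Function.Surjective g) : i = j := by
  obtain ⟨y, hy⟩ := (properU A e i).mkQ_surjective (g (leftIdealGen (e j)))
  obtain ⟨x, hx⟩ := hg ((properU A e i).mkQ (leftIdealGen (e i)))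
  have hgen : e j • leftIdealGen (e j) = leftIdealGen (e j) :=
    smul_leftIdealGen (h.idem j) (leftIdealGen (e j))
  have hxy : x.1 • e j • y - leftIdealGen (e i) ∈ properU A e i := by
    rw [← (properU A e i).ker_mkQ, LinearMap.mem_ker, map_sub, map_smul, map_smul, hy, ← map_smul,
      hgen, ← map_smul, smul_leftIdealGen (h.idem j), hx, sub_self]
  have hr := val_mem_jacRad_of_mem_properU h.idem hxy
  obtain ⟨s, hs⟩ := exists_mul_one_add_eq_one hr
  have hyi : y.1 * e i = y.1 := (mem_leftIdeal_iff (h.idem i)).1 y.2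
  have hval : (x.1 • e j • y - leftIdealGen (e i)).1 = x.1 * (e j * y.1) - e i := rfl
  refine h.eq_of_mul_eq (a := s * x.1) (b := e j * y.1) (by rw [← mul_assoc, (h.idem j).eq])
    (by rw [mul_assoc, hyi]) ?_
  calc s * x.1 * (e j * y.1) = s * (1 + (x.1 * (e j * y.1) - e i)) * e i := by
        rw [mul_assoc, mul_assoc s, add_mul, sub_mul, (h.idem i).eq, mul_assoc x.1, mul_assoc (e j),
          hyi, one_mul, add_sub_cancel]
    _ = e i := by rw [← hval, hs, one_mul]

theorem smul_mem_properU (K : Type*) [Field K] [Algebra K A] [FiniteDimensional K A]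
    {i j : Fin n} (hij : i < j) (x : leftIdeal A (e i)) : e j • x ∈ properU A e i := by
  rw [properU_eq_span h.idem]
  have hjx : e j * (e j * x.1) = e j * x.1 := by rw [← mul_assoc, (h.idem j).eq]
  have hxi : e j * x.1 * e i = e j * x.1 := by
    rw [mul_assoc, (mem_leftIdeal_iff (h.idem i)).1 x.2]
  exact Submodule.subset_span ⟨j, hij.le, (h.prim i).mem_jacRad K hxi fun a ha =>
    hij.ne (h.eq_of_mul_eq hjx hxi ha), hjx⟩

theorem sumLater_smul_mem_properU (K : Type*) [Field K] [Algebra K A] [FiniteDimensional K A]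
    {i j : Fin n} (hji : j ≤ i) (x : leftIdeal A (e j)) :
    sumLater A e i • x ∈ properU A e j := by
  rw [sumLater, Finset.sum_smul]
  exact Submodule.sum_mem _ fun l hl =>
    h.smul_mem_properU K (hji.trans_lt (by simpa using hl)) x

theorem sumLater_smul (K : Type*) [Field K] [Algebra K A] [FiniteDimensional K A]
    {i j : Fin n} (hji : j ≤ i) (x : PStd A e j) : sumLater A e i • x = 0 := by
  obtain ⟨x, rfl⟩ := Submodule.mkQ_surjective _ x
  rw [← map_smul, ← LinearMap.mem_ker, Submodule.ker_mkQ]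
  exact h.sumLater_smul_mem_properU K hji x

theorem exists_filtration {j : Fin n}
    (hfilt : HasPStdFilt A e (fun l => j ≤ l) (leftIdeal A (e j))) :
    ∃ (m : ℕ) (X : ℕ → Submodule A (leftIdeal A (e j))) (g : leftIdeal A (e j) →ₗ[A] PStd A e j),
      1 ≤ m ∧ X m = ⊥ ∧ (∀ t, X (t + 1) ≤ X t) ∧ Function.Surjective g ∧
      LinearMap.ker g = X 1 ∧ ∀ t, 1 ≤ t → t < m → ∃ l, j ≤ l ∧ Nonempty
        ((↥(X t) ⧸ Submodule.comap (X t).subtype (X (t + 1))) ≃ₗ[A] PStd A e l) := by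
  obtain ⟨m, X, h0, hm, hle, hX⟩ := hfilt
  have hm0 : m ≠ 0 := by
    rintro rfl
    have hmem : leftIdealGen (e j) ∈ X 0 := h0 ▸ Submodule.mem_top
    rw [hm] at hmem
    exact (h.prim j).2.1 (congrArg Subtype.val ((Submodule.mem_bot _).1 hmem))
  obtain ⟨l, -, ⟨α⟩⟩ := hX 0 (by omega)
  let g : leftIdeal A (e j) →ₗ[A] PStd A e l :=
    α.toLinearMap ∘ₗ (Submodule.comap (X 0).subtype (X 1)).mkQ ∘ₗ
      (LinearEquiv.ofTop (X 0) h0).symm.toLinearMap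
  have hg : Function.Surjective g := α.surjective.comp
    ((Submodule.mkQ_surjective _).comp (LinearEquiv.surjective _))
  obtain rfl := h.eq_of_surjective g hg
  refine ⟨m, X, g, by omega, hm, hle, hg, ?_, fun t _ ht => hX t ht⟩
  ext x
  simp [g]

theorem isTraceResolved_pStd
    (hfilt : ∀ j, HasPStdFilt A e (fun l => j ≤ l) (leftIdeal A (e j))) {i : Fin n} (k : ℕ) :
    ∀ j, i < j → IsTraceResolved (sumLater A e i) k (PStd A e j) := by
  have htop : ∀ j, i < j → traceSub (sumLater A e i) (leftIdeal A (e j)) = ⊤ := by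
    refine fun j hij => eq_top_iff.2 fun x _ => ?_
    rw [← smul_leftIdealGen (h.idem j) x]
    have : leftIdealGen (e j) = sumLater A e i • leftIdealGen (e j) :=
      Subtype.ext (h.sumLater_mul_of_lt hij).symm
    rw [this]
    exact Submodule.smul_mem _ _ (smul_mem_traceSub _)
  induction k with
  | zero =>
    exact fun j hij => traceSub_eq_top_of_surjective _ (Submodule.mkQ_surjective _) (htop j hij)
  | succ k ih =>
    intro j hij
    obtain ⟨m, X, g, hm1, hm, hle, hg, hker, hX⟩ := h.exists_filtration (hfilt j)
    refine ⟨leftIdeal A (e j), _, _, g, leftIdeal_projective (h.idem j), htop j hij, hg, ?_⟩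
    rw [hker]
    exact filtration_induction (Ψ := fun X _ _ => IsTraceResolved (sumLater A e i) k X)
      (fun X _ _ _ => isTraceResolved_of_subsingleton k X)
      (fun X Y Z _ _ _ _ _ _ f g hf hg hfg hX hZ => .of_exact f g hf hg hfg hX hZ)
      hm hle hm1 (fun l hl => ih l (hij.trans_le hl)) hX

theorem hasResolvedTrace_leftIdeal (K : Type*) [Field K] [Algebra K A] [FiniteDimensional K A]
    (hfilt : ∀ j, HasPStdFilt A e (fun l => j ≤ l) (leftIdeal A (e j))) (i j : Fin n) :
    HasResolvedTrace (sumLater A e i) (leftIdeal A (e j)) := by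
  have hstd : ∀ l, HasResolvedTrace (sumLater A e i) (PStd A e l) := fun l => by
    rcases lt_or_ge i l with hil | hli
    · exact hasResolvedTrace_of_forall fun k => h.isTraceResolved_pStd hfilt k l hil
    · refine hasResolvedTrace_of_traceSub_eq_bot (eq_bot_iff.2 (traceSub_le.2 fun x => ?_))
      rw [h.sumLater_smul K hli]
      exact zero_mem _
  have hε := h.isIdempotentElem_sumLater i
  obtain ⟨m, X, g, hm1, hm, hle, hg, hker, hX⟩ := h.exists_filtration (hfilt j)
  have h1 : HasResolvedTrace (sumLater A e i) (X 1) :=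
    filtration_induction (Ψ := fun X _ _ => HasResolvedTrace (sumLater A e i) X)
      (fun X _ _ _ k => isTraceResolved_of_subsingleton k _)
      (fun X Y Z _ _ _ _ _ _ f g hf hg hfg hX hZ => .of_exact hε f g hf hg hfg hX hZ)
      hm hle hm1 (fun l _ => hstd l) hX
  exact .of_exact hε (X 1).subtype g Subtype.val_injective hg
    (LinearMap.exact_iff.2 (by simp [hker])) h1 (hstd j)

theorem hasResolvedTrace (K : Type*) [Field K] [Algebra K A] [FiniteDimensional K A]
    (hfilt : ∀ j, HasPStdFilt A e (fun l => j ≤ l) (leftIdeal A (e j))) (i : Fin n) :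
    HasResolvedTrace (sumLater A e i) A := by
  have hε := h.isIdempotentElem_sumLater i
  have key : ∀ s : Finset (Fin n),
      HasResolvedTrace (sumLater A e i) (leftIdeal A (∑ j ∈ s, e j)) := by
    intro s
    induction s using Finset.induction_on with
    | empty =>
      have : Subsingleton (leftIdeal A (∑ j ∈ (∅ : Finset (Fin n)), e j)) :=
        ⟨fun x y => by
          obtain ⟨⟨_, x, rfl⟩, _, y, rfl⟩ := x, y
          simp [mulRightLin]⟩
      exact fun k => isTraceResolved_of_subsingleton k _
    | insert j s hj ih =>
      have hsj : (∑ l ∈ s, e l) * e j = 0 := by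
        rw [Finset.sum_mul]
        exact Finset.sum_eq_zero fun l hl => h.orth l j fun hlj => hj (hlj ▸ hl)
      have hjs : e j * (∑ l ∈ s, e l) = 0 := by
        rw [Finset.mul_sum]
        exact Finset.sum_eq_zero fun l hl => h.orth j l fun hlj => hj (hlj ▸ hl)
      have hss : (∑ l ∈ s, e l) * (∑ l ∈ s, e l) = ∑ l ∈ s, e l := by
        rw [Finset.mul_sum]
        refine Finset.sum_congr rfl fun l hl => ?_
        rw [Finset.sum_mul, Finset.sum_eq_single_of_mem l hl fun b _ hb => h.orth b l hb,
          (h.idem l).eq]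
      rw [Finset.sum_insert hj]
      set f := ∑ l ∈ s, e l
      have hle : leftIdeal A f ≤ leftIdeal A (e j + f) := by
        rintro _ ⟨x, rfl⟩
        exact ⟨x * f, by simp [mulRightLin, mul_assoc, mul_add, hsj, hss]⟩
      refine .of_exact hε (Submodule.inclusion hle)
        ((mulRightLin A (e j)).restrict (p := leftIdeal A (e j + f)) (q := leftIdeal A (e j))
          fun x _ => ⟨x, rfl⟩)
        (Submodule.inclusion_injective _) ?_ ?_ ih (h.hasResolvedTrace_leftIdeal K hfilt i j)
      · rintro ⟨_, x, rfl⟩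
        exact ⟨⟨x * e j, x * e j, by simp [mulRightLin, mul_assoc, mul_add, hjs, (h.idem j).eq]⟩,
          Subtype.ext (by simp [mulRightLin, mul_assoc, (h.idem j).eq])⟩
      · rintro ⟨_, x, rfl⟩
        constructor
        · intro hx
          have hx : x * (e j + f) * e j = 0 := congrArg Subtype.val hx
          have hxj : x * e j = 0 := by
            simpa [mul_assoc, add_mul, mul_add, hsj, (h.idem j).eq] using hx
          exact ⟨⟨x * f, x, rfl⟩, Subtype.ext (by simp [mulRightLin, mul_add, hxj])⟩
        · rintro ⟨⟨_, y, rfl⟩, hy⟩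
          have hy : y * f = x * (e j + f) := congrArg Subtype.val hy
          refine Subtype.ext ?_
          change x * (e j + f) * e j = 0
          rw [← hy, mul_assoc, hsj, mul_zero]
  have h1 := key Finset.univ
  rw [h.complete] at h1
  have htop : ∀ x : A, x ∈ leftIdeal A (1 : A) := fun x => ⟨x, mul_one x⟩
  refine .of_exact hε (leftIdeal A (1 : A)).subtype (0 : A →ₗ[A] PUnit.{u + 1}) Subtype.val_injective
    (fun x => ⟨0, Subsingleton.elim _ _⟩) (fun x => ?_) h1
    fun k => isTraceResolved_of_subsingleton k _
  simp [htop]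

/-- The projection `A ↠ A/AεA` induces a bijection on the `i`-th properly standard modules. -/
theorem exists_pStd_addEquiv (K : Type*) [Field K] [Algebra K A] [FiniteDimensional K A]
    (i : Fin n) {A' : Type*} [Ring A'] (ρ : A →+* A') (hρsurj : Function.Surjective ρ)
    (hρker : ∀ a, ρ a = 0 ↔ a ∈ traceSub (sumLater A e i) A) :
    ∃ f : PStd A e i ≃+ PStd A' (fun j => ρ (e j)) i,
      ∀ (a : A) (x : PStd A e i), f (a • x) = ρ a • f x := by
  have hidem' : ∀ j, IsIdempotentElem (ρ (e j)) := fun j => (h.idem j).map ρ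
  let g : leftIdeal A (e i) →ₛₗ[ρ] leftIdeal A' (ρ (e i)) :=
    { toFun := fun x => ⟨ρ x.1, (mem_leftIdeal_iff (hidem' i)).2 <| by
        rw [← map_mul, (mem_leftIdeal_iff (h.idem i)).1 x.2]⟩
      map_add' := fun x y => Subtype.ext (map_add ρ _ _)
      map_smul' := fun a x => Subtype.ext (map_mul ρ _ _) }
  have hgsurj : Function.Surjective g := fun ⟨y, hy⟩ => by
    obtain ⟨a, rfl⟩ := hρsurj y
    refine ⟨⟨a * e i, mul_mem_leftIdeal a _⟩, Subtype.ext ?_⟩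
    exact (map_mul ρ _ _).trans ((mem_leftIdeal_iff (hidem' i)).1 hy)
  have : RingHomSurjective ρ := ⟨hρsurj⟩
  have hρε : ρ (sumLater A e i) = 0 := (hρker _).2 (by
    simpa using smul_mem_traceSub (ε := sumLater A e i) (1 : A))
  have hker : ∀ x, g x = 0 → x ∈ properU A e i := by
    intro x hx
    have hx := (hρker x.1).1 (congrArg Subtype.val hx)
    have hle : traceSub (sumLater A e i) A ≤ (properU A e i).comap
        (toLeftIdeal (e i)) := traceSub_le.2 fun y => by
      rw [Submodule.mem_comap, map_smul]
      exact h.sumLater_smul_mem_properU K le_rfl _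
    have : toLeftIdeal (e i) x.1 = x :=
      Subtype.ext ((mem_leftIdeal_iff (h.idem i)).1 x.2)
    exact this ▸ hle hx
  have hle : properU A e i ≤ (properU A' (fun j => ρ (e j)) i).comap g := by
    rw [properU_eq_span h.idem, properU_eq_span hidem', Submodule.span_le]
    rintro x ⟨j, hij, hx, hjx⟩
    exact Submodule.subset_span ⟨j, hij, map_mem_jacRad hρsurj hx, by
      change ρ (e j) * ρ x.1 = ρ x.1
      rw [← map_mul, hjx]⟩
  have hge : properU A' (fun j => ρ (e j)) i ≤ (properU A e i).map g := by
    rw [properU_eq_span hidem', Submodule.span_le]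
    rintro y ⟨j, hij, hy, hjy⟩
    obtain ⟨x, rfl⟩ := hgsurj y
    rcases hij.lt_or_eq with hij | rfl
    · refine ⟨0, zero_mem _, ?_⟩
      rw [map_zero]
      exact Subtype.ext (by rw [← hjy, h.map_sumLater hρε hij, zero_mul]; rfl)
    · refine ⟨e i • x, ?_, Subtype.ext ?_⟩
      · have hix : e i * (e i * x.1) = e i * x.1 := by rw [← mul_assoc, (h.idem i).eq]
        by_cases ha : ∃ a, a * (e i * x.1) = e i
        · obtain ⟨a, ha⟩ := ha
          have hJ : ρ (e i) ∈ jacRad A' := by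
            rw [← ha, map_mul, map_mul]
            exact Ideal.mul_mem_left _ _ (Ideal.mul_mem_left _ _ hy)
          refine hker _ (Subtype.ext ?_)
          change ρ (e i * x.1) = 0
          rw [map_mul, eq_zero_of_isIdempotentElem_of_mem_jacRad (hidem' i) hJ, zero_mul]
        · rw [properU_eq_span h.idem]
          refine Submodule.subset_span ⟨i, le_rfl, (h.prim i).mem_jacRad K ?_ (not_exists.1 ha), hix⟩
          exact (mul_assoc _ _ _).trans
            (congrArg _ ((mem_leftIdeal_iff (h.idem i)).1 x.2))
      · exact (map_mul ρ _ _).trans hjy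
  let f : PStd A e i →ₛₗ[ρ] PStd A' (fun j => ρ (e j)) i :=
    (properU A e i).mapQ (properU A' (fun j => ρ (e j)) i) g hle
  have hf : ∀ x, f ((properU A e i).mkQ x) = (properU A' (fun j => ρ (e j)) i).mkQ (g x) :=
    fun _ => rfl
  refine ⟨.ofBijective f.toAddMonoidHom ⟨(injective_iff_map_eq_zero _).2 fun x hx => ?_,
    fun y => ?_⟩, fun a x => map_smulₛₗ f a x⟩
  · obtain ⟨x, rfl⟩ := Submodule.mkQ_surjective _ x
    have hx : f ((properU A e i).mkQ x) = 0 := hx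
    rw [hf, ← LinearMap.mem_ker, Submodule.ker_mkQ] at hx
    obtain ⟨z, hz, hzx⟩ := hge hx
    have := add_mem hz (hker (x - z) (by rw [map_sub, hzx, sub_self]))
    rwa [add_sub_cancel, ← Submodule.ker_mkQ (properU A e i), LinearMap.mem_ker] at this
  · obtain ⟨y, rfl⟩ := Submodule.mkQ_surjective _ y
    obtain ⟨x, rfl⟩ := hgsurj y
    exact ⟨(properU A e i).mkQ x, hf x⟩

end IsBasicSystem

end Filtration


section SemilinearComplexes

theorem exists_seq {T : ℕ → Type*} (Q : ∀ m, T m → Prop) (R : ∀ m, T m → T (m + 1) → Prop)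
    {t₀ : T 0} (h₀ : Q 0 t₀) (step : ∀ m t, Q m t → ∃ t', Q (m + 1) t' ∧ R m t t') :
    ∃ t : ∀ m, T m, t 0 = t₀ ∧ ∀ m, R m (t m) (t (m + 1)) := by
  choose next hQ hR using step
  let s : ∀ m, {t : T m // Q m t} := fun m =>
    Nat.rec ⟨t₀, h₀⟩ (fun m t => ⟨next m t.1 t.2, hQ m t.1 t.2⟩) m
  exact ⟨fun m => (s m).1, rfl, fun m => hR m _ (s m).2⟩

variable {R S T : Type*} [Ring R] [Ring S] [Ring T] {σ : R →+* S} {τ : S →+* T} {στ : R →+* T}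
  [RingHomCompTriple σ τ στ]

theorem exists_semilinear_lift {C N N' : Type*} [AddCommGroup C] [Module R C]
    [Module.Projective R C] [AddCommGroup N] [Module S N] [AddCommGroup N'] [Module T N']
    (g : N →ₛₗ[τ] N') (u : C →ₛₗ[στ] N') (hu : ∀ c, ∃ x, g x = u c) :
    ∃ v : C →ₛₗ[σ] N, ∀ c, g (v c) = u c := by
  let _ : Module R N := Module.compHom N σ
  let _ : Module R N' := Module.compHom N' στ
  have hN : ∀ (r : R) (x : N), r • x = σ r • x := fun _ _ => rfl
  have hN' : ∀ (r : R) (x : N'), r • x = στ r • x := fun _ _ => rfl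
  let g' : N →ₗ[R] N' :=
    { toFun := g
      map_add' := map_add g
      map_smul' := fun r x => by
        rw [hN, hN', map_smulₛₗ, RingHomCompTriple.comp_apply, RingHom.id_apply] }
  let u' : C →ₗ[R] N' :=
    { toFun := u
      map_add' := map_add u
      map_smul' := fun r x => by rw [hN', map_smulₛₗ, RingHom.id_apply] }
  obtain ⟨v, hv⟩ := Module.projective_lifting_property g'.rangeRestrict
    (u'.codRestrict (LinearMap.range g') hu) g'.surjective_rangeRestrict
  refine ⟨{ toFun := v, map_add' := map_add v, map_smul' := fun r x => map_smul v r x },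
    fun c => ?_⟩
  exact congrArg Subtype.val (LinearMap.congr_fun hv c)

/-- `u : C l → N` is a coboundary of the complex `Hom(C, N)`. -/
def IsCob {C : ℕ → Type*} [∀ l, AddCommGroup (C l)] [∀ l, Module R (C l)]
    (d : ∀ l, C (l + 1) →ₗ[R] C l) {N : Type*} [AddCommGroup N] [Module S N] :
    ∀ l, (C l →ₛₗ[σ] N) → Prop
  | 0, u => ∀ x, u x = 0
  | l + 1, u => ∃ w : C l →ₛₗ[σ] N, ∀ x, u x = w (d l x)

section Cob

variable {C : ℕ → Type*} [∀ l, AddCommGroup (C l)] [∀ l, Module R (C l)]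
  {d : ∀ l, C (l + 1) →ₗ[R] C l} {N : Type*} [AddCommGroup N] [Module S N]
  {l : ℕ} {u v : C l →ₛₗ[σ] N}

theorem isCob_zero : ∀ l, IsCob d l (0 : C l →ₛₗ[σ] N)
  | 0 => fun _ => rfl
  | _ + 1 => ⟨0, fun _ => rfl⟩

theorem IsCob.congr (hu : IsCob d l u) (h : ∀ x, v x = u x) : IsCob d l v :=
  LinearMap.ext h ▸ hu

theorem IsCob.add (hu : IsCob d l u) (hv : IsCob d l v) : IsCob d l (u + v) := by
  cases l with
  | zero => exact fun x => by simp [hu x, hv x]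
  | succ l =>
    obtain ⟨w, hw⟩ := hu
    obtain ⟨w', hw'⟩ := hv
    exact ⟨w + w', fun x => by simp [hw, hw']⟩

theorem IsCob.comp {N' : Type*} [AddCommGroup N'] [Module T N'] (g : N →ₛₗ[τ] N')
    (hu : IsCob d l u) : IsCob d l (g.comp u : C l →ₛₗ[στ] N') := by
  cases l with
  | zero => exact fun x => by simp [hu x]
  | succ l =>
    obtain ⟨w, hw⟩ := hu
    exact ⟨(g.comp w : C l →ₛₗ[στ] N'), fun x => by simp [hw]⟩

theorem IsCob.neg (hu : IsCob d l u) : IsCob d l (-u) := by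
  cases l with
  | zero => exact fun x => by simp [hu x]
  | succ l =>
    obtain ⟨w, hw⟩ := hu
    exact ⟨-w, fun x => by simp [hw]⟩

theorem IsCob.map_d (hdd : ∀ l x, d l (d (l + 1) x) = 0) (hu : IsCob d l u) (x : C (l + 1)) :
    u (d l x) = 0 := by
  cases l with
  | zero => exact hu _
  | succ l =>
    obtain ⟨w, hw⟩ := hu
    rw [hw, hdd, map_zero]

theorem isCob_comp_d (w : C l →ₛₗ[σ] N) : IsCob d (l + 1) (w.comp (d l)) := ⟨w, fun _ => rfl⟩

theorem IsCob.exists_lift [∀ l, Module.Projective R (C l)] {N' : Type*} [AddCommGroup N']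
    [Module T N'] (g : N →ₛₗ[τ] N') (hg : Function.Surjective g) {u : C l →ₛₗ[στ] N'}
    (hu : IsCob d l u) : ∃ b : C l →ₛₗ[σ] N, IsCob d l b ∧ ∀ x, g (b x) = u x := by
  cases l with
  | zero => exact ⟨0, isCob_zero 0, fun x => by simp [hu x]⟩
  | succ l =>
    obtain ⟨w, hw⟩ := hu
    obtain ⟨w', hw'⟩ := exists_semilinear_lift (σ := σ) g w fun c => hg _
    exact ⟨w'.comp (d l), isCob_comp_d w', fun x => by simp [hw, hw']⟩

end Cob

variable {c : ℕ → Type*} [∀ m, AddCommGroup (c m)] [∀ m, Module R (c m)]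
  [∀ m, Module.Projective R (c m)] {D : ℕ → Type*} [∀ m, AddCommGroup (D m)]
  [∀ m, Module S (D m)] {M : Type*} [AddCommGroup M] [Module T M]

/-- The comparison theorem: a cocycle with values in `M` lifts to a chain map into a resolution
of `M`. -/
theorem exists_chainMap (dc : ∀ m, c (m + 1) →ₗ[R] c m) (dD : ∀ m, D (m + 1) →ₗ[S] D m)
    (π : D 0 →ₛₗ[τ] M) (hdc : ∀ m x, dc m (dc (m + 1) x) = 0) (hπ : Function.Surjective π)
    (hD0 : Function.Exact (dD 0) π) (hD : ∀ m, Function.Exact (dD (m + 1)) (dD m))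
    {s : ℤ} (hs : s = 1 ∨ s = -1) (u : c 0 →ₛₗ[στ] M) (hu : ∀ x, u (dc 0 x) = 0) :
    ∃ z : ∀ m, c m →ₛₗ[σ] D m, (∀ x, π (z 0 x) = u x) ∧
      ∀ m x, z m (dc m x) = s • dD m (z (m + 1) x) := by
  obtain ⟨z₀, hz₀⟩ := exists_semilinear_lift (σ := σ) π u fun c => hπ _
  obtain ⟨z, h0, hz⟩ := exists_seq (T := fun m => c m →ₛₗ[σ] D m)
    (fun m z => ∀ x, ∃ y, dD m y = z (dc m x))
    (fun m z z' => ∀ x, z (dc m x) = s • dD m (z' x)) (t₀ := z₀)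
    (fun x => (hD0 _).1 ((hz₀ _).trans (hu x))) fun m z hz => by
      obtain ⟨z', hz'⟩ := exists_semilinear_lift (σ := σ) (dD m) (s • z.comp (dc m)) fun x => by
        obtain ⟨y, hy⟩ := hz x
        exact ⟨s • y, by simp [hy]⟩
      refine ⟨z', fun x => (hD m _).1 ?_, fun x => ?_⟩
      · simp [hz', hdc]
      · rw [hz']
        rcases hs with rfl | rfl <;> simp
  exact ⟨z, by rwa [h0], hz⟩

/-- A chain map whose augmentation vanishes up to a coboundary `B` is homotopic to `B`. -/
theorem exists_homotopy (dc : ∀ m, c (m + 1) →ₗ[R] c m) (dD : ∀ m, D (m + 1) →ₗ[S] D m)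
    (π : D 0 →ₛₗ[τ] M) (hdc : ∀ m x, dc m (dc (m + 1) x) = 0)
    (hD0 : Function.Exact (dD 0) π) (hD : ∀ m, Function.Exact (dD (m + 1)) (dD m))
    {s : ℤ} (hs : s = 1 ∨ s = -1) (z : ∀ m, c m →ₛₗ[σ] D m)
    (hz : ∀ m x, z m (dc m x) = s • dD m (z (m + 1) x)) (B : c 0 →ₛₗ[σ] D 0)
    (hB : ∀ x, B (dc 0 x) = 0) (hzB : ∀ x, π (z 0 x) = π (B x)) :
    ∃ H : ∀ m, c m →ₛₗ[σ] D (m + 1), (∀ x, z 0 x = dD 0 (H 0 x) + B x) ∧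
      ∀ m x, z (m + 1) x = dD (m + 1) (H (m + 1) x) + s • H m (dc m x) := by
  have hz' : ∀ m x, dD m (z (m + 1) x) = s • z m (dc m x) := fun m x => by
    rw [hz]
    rcases hs with rfl | rfl <;> simp
  obtain ⟨H₀, hH₀⟩ := exists_semilinear_lift (σ := σ) (dD 0) (z 0 - B) fun x =>
    (hD0 _).1 (by simp [hzB])
  obtain ⟨H, h0, hH⟩ := exists_seq (T := fun m => c m →ₛₗ[σ] D (m + 1))
    (fun m H => ∀ x, ∃ y, dD (m + 1) y = (z (m + 1) - s • H.comp (dc m)) x)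
    (fun m H H' => ∀ x, z (m + 1) x = dD (m + 1) (H' x) + s • H (dc m x)) (t₀ := H₀)
    (fun x => (hD 0 _).1 (by simp [hz', hH₀, hB])) fun m H hH => by
      obtain ⟨H', hH'⟩ := exists_semilinear_lift (σ := σ) (dD (m + 1)) _ hH
      exact ⟨H', fun x => (hD (m + 1) _).1 (by simp [hz', hH', hdc]), fun x => by simp [hH']⟩
  exact ⟨H, fun x => by simp [h0, hH₀], hH⟩

end SemilinearComplexes


section Cone

open CategoryTheory in
theorem ExtVanishes.prod {A : Type u} [Ring A] {X Y N : Type u} [AddCommGroup X] [Module A X]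
    [AddCommGroup Y] [Module A Y] [AddCommGroup N] [Module A N] {k : ℕ}
    (hX : ExtVanishes A X N k) (hY : ExtVanishes A Y N k) : ExtVanishes A (X × Y) N k := by
  have hX : Subsingleton (Abelian.Ext (ModuleCat.of A X) (ModuleCat.of A N) k) := hX
  have hY : Subsingleton (Abelian.Ext (ModuleCat.of A Y) (ModuleCat.of A N) k) := hY
  refine subsingleton_of_forall_eq 0 fun x => ?_
  obtain ⟨y, rfl⟩ := Abelian.Ext.contravariant_sequence_exact₂
    (shortExact_of_exact (LinearMap.inl A X Y) (LinearMap.snd A X Y) LinearMap.inl_injective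
      LinearMap.snd_surjective .inl_snd) _ x (Subsingleton.elim _ _)
  rw [Subsingleton.elim y 0, Abelian.Ext.comp_zero]

variable {A : Type u} [Ring A] (P P' : ℕ → Type u) [∀ l, AddCommGroup (P l)]
  [∀ l, Module A (P l)] [∀ l, AddCommGroup (P' l)] [∀ l, Module A (P' l)]

/-- The terms of the mapping cone of a chain map `P' → P`. -/
def ConeTerm : ℕ → Type u
  | 0 => P 0
  | l + 1 => P (l + 1) × P' l

instance : ∀ l, AddCommGroup (ConeTerm P P' l)
  | 0 => inferInstanceAs (AddCommGroup (P 0))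
  | l + 1 => inferInstanceAs (AddCommGroup (P (l + 1) × P' l))

instance : ∀ l, Module A (ConeTerm P P' l)
  | 0 => inferInstanceAs (Module A (P 0))
  | l + 1 => inferInstanceAs (Module A (P (l + 1) × P' l))

variable {P P'} (dP : ∀ l, P (l + 1) →ₗ[A] P l) (dP' : ∀ l, P' (l + 1) →ₗ[A] P' l)
  (f : ∀ l, P' l →ₗ[A] P l)

/-- The differential of the mapping cone of `f : P' → P`. -/
def coneD : ∀ l, ConeTerm P P' (l + 1) →ₗ[A] ConeTerm P P' l
  | 0 => (dP 0).coprod (f 0)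
  | l + 1 => ((dP (l + 1)).coprod (f (l + 1))).prod (-(dP' l ∘ₗ LinearMap.snd A _ _))

variable {dP dP' f} {M : Type u} [AddCommGroup M] [Module A M] {π : P 0 →ₗ[A] M}
  {π' : P' 0 →ₗ[A] M} (hP0 : Function.Exact (dP 0) π)
  (hP : ∀ l, Function.Exact (dP (l + 1)) (dP l)) (hπ' : Function.Surjective π')
  (hP'0 : Function.Exact (dP' 0) π') (hP' : ∀ l, Function.Exact (dP' (l + 1)) (dP' l))
  (hf0 : ∀ x, π (f 0 x) = π' x) (hf : ∀ l x, f l (dP' l x) = dP l (f (l + 1) x))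

include hP0 hπ' hf0 in
theorem coneD_zero_surjective : Function.Surjective (coneD dP dP' f 0) := by
  have key : ∀ x : P 0, ∃ y : P 1 × P' 0, dP 0 y.1 + f 0 y.2 = x := fun x => by
    obtain ⟨q, hq⟩ := hπ' (π x)
    obtain ⟨p, hp⟩ := (hP0 (x - f 0 q)).1 (by simp [hf0, hq])
    exact ⟨(p, q), by simp [hp]⟩
  exact key

include hP0 hP hP'0 hP' hf0 hf in
theorem coneD_exact (l : ℕ) : Function.Exact (coneD dP dP' f (l + 1)) (coneD dP dP' f l) := by
  have hdd : ∀ l x, dP l (dP (l + 1) x) = 0 := fun l x => (hP l _).2 ⟨x, rfl⟩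
  have hdd' : ∀ l x, dP' l (dP' (l + 1) x) = 0 := fun l x => (hP' l _).2 ⟨x, rfl⟩
  have key : ∀ (p : P (l + 1)) (q : P' l), dP l p + f l q = 0 → (∃ q', dP' l q' = q) →
      ∃ y : P (l + 2) × P' (l + 1), (dP (l + 1) y.1 + f (l + 1) y.2, -dP' l y.2) = (p, q) := by
    rintro p _ hpq ⟨q, rfl⟩
    obtain ⟨p', hp'⟩ := (hP l (p + f (l + 1) q)).1 (by rw [map_add, ← hf, hpq])
    exact ⟨(p', -q), by simp [hp']⟩
  rcases l with _ | l
  · rintro ⟨p, q⟩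
    constructor
    · intro h
      have h : dP 0 p + f 0 q = 0 := h
      refine key p q h ((hP'0 q).1 ?_)
      rw [← hf0, eq_neg_of_add_eq_zero_right h, map_neg, (hP0 _).2 ⟨p, rfl⟩, neg_zero]
    · rintro ⟨⟨p', q'⟩, h⟩
      obtain ⟨rfl, rfl⟩ := Prod.ext_iff.1 h
      change dP 0 (dP 1 p' + f 1 q') + f 0 (-dP' 0 q') = 0
      rw [map_add, hdd, map_neg, hf, zero_add, add_neg_cancel]
  · rintro ⟨p, q⟩
    constructor
    · intro h
      obtain ⟨h1, h2⟩ := Prod.ext_iff.1 h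
      exact key p q h1 ((hP' l q).1 (neg_eq_zero.1 h2))
    · rintro ⟨⟨p', q'⟩, h⟩
      obtain ⟨rfl, rfl⟩ := Prod.ext_iff.1 h
      refine Prod.ext ?_ ?_
      · change dP (l + 1) (dP (l + 2) p' + f (l + 2) q') + f (l + 1) (-dP' (l + 1) q') = 0
        rw [map_add, hdd, map_neg, hf, zero_add, add_neg_cancel]
      · change -dP' l (-dP' (l + 1) q') = 0
        rw [map_neg, hdd', neg_zero, neg_zero]

variable [∀ l, Module.Projective A (P' l)] {N : Type u} [AddCommGroup N] [Module A N]
  (hPN : ∀ l k, ExtVanishes A (P l) N (k + 1))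

include hPN in
theorem coneTerm_extVanishes : ∀ l k, ExtVanishes A (ConeTerm P P' l) N (k + 1)
  | 0, k => hPN 0 k
  | l + 1, k => (hPN (l + 1) k).prod (extVanishes_of_projective k)

include hP0 hP hπ' hP'0 hP' hf0 hf hPN

/-- A resolution by `Hom(-, N)`-acyclic modules computes the cohomology of `Hom(P', N)`, where
`P'` is a projective resolution (surjectivity). -/
theorem exists_isCob_sub_comp {k : ℕ} (u : P' k →ₗ[A] N) (hu : ∀ x, u (dP' k x) = 0) :
    ∃ v : P k →ₗ[A] N, (∀ x, v (dP k x) = 0) ∧ IsCob dP' k (u - v ∘ₗ f k) := by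
  obtain ⟨w, hw⟩ := exists_eq_comp_of_exact (coneD dP dP' f) (coneD_zero_surjective hP0 hπ' hf0)
    (coneD_exact hP0 hP hP'0 hP' hf0 hf) (coneTerm_extVanishes hPN) k
    (u ∘ₗ LinearMap.snd A (P (k + 1)) (P' k)) <| LinearMap.ext fun x => by
      change u (-dP' k x.2) = 0
      rw [map_neg, hu, neg_zero]
  have hw : ∀ p q, w (coneD dP dP' f k (p, q)) = u q := fun p q => LinearMap.congr_fun hw (p, q)
  rcases k with _ | k
  · let w' : P 0 →ₗ[A] N := w
    have hw : ∀ p q, w' (dP 0 p + f 0 q) = u q := hw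
    refine ⟨w', fun x => ?_, fun x => ?_⟩
    · simpa using hw x 0
    · have := hw 0 x
      rw [map_zero, zero_add] at this
      simpa [sub_eq_zero] using this.symm
  · let w' : P (k + 1) × P' k →ₗ[A] N := w
    have hw : ∀ p q, w' (dP (k + 1) p + f (k + 1) q, -dP' k q) = u q := hw
    refine ⟨w' ∘ₗ LinearMap.inl A _ _, fun x => by simpa using hw x 0,
      -(w' ∘ₗ LinearMap.inr A _ _), fun x => ?_⟩
    have h1 := hw 0 x
    rw [map_zero, zero_add] at h1
    have h2 : w' (f (k + 1) x, -dP' k x) = w' (f (k + 1) x, 0) - w' (0, dP' k x) := by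
      rw [← map_sub, Prod.mk_sub_mk, sub_zero, zero_sub]
    simp [← h1, h2]

/-- A resolution by `Hom(-, N)`-acyclic modules computes the cohomology of `Hom(P', N)`, where
`P'` is a projective resolution (injectivity). -/
theorem isCob_of_isCob_comp {k : ℕ} (v : P k →ₗ[A] N) (hv : ∀ x, v (dP k x) = 0)
    (hvf : IsCob dP' k (v ∘ₗ f k)) : IsCob dP k v := by
  rcases k with _ | k
  · intro x
    obtain ⟨⟨p, q⟩, rfl⟩ := coneD_zero_surjective (dP' := dP') hP0 hπ' hf0 x
    change v (dP 0 p + f 0 q) = 0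
    rw [map_add, hv, zero_add]
    exact hvf q
  · obtain ⟨w, hw⟩ := hvf
    have hw : ∀ x, v (f (k + 1) x) = w (dP' k x) := hw
    obtain ⟨W, hW⟩ := exists_eq_comp_of_exact (coneD dP dP' f)
      (coneD_zero_surjective hP0 hπ' hf0) (coneD_exact hP0 hP hP'0 hP' hf0 hf)
      (coneTerm_extVanishes hPN) k (v.coprod w) <| LinearMap.ext fun x => by
        change v (dP (k + 1) x.1 + f (k + 1) x.2) + w (-dP' k x.2) = 0
        rw [map_add, hv, hw, map_neg, zero_add, add_neg_cancel]
    have hW : ∀ p, W (coneD dP dP' f k (p, 0)) = v p := fun p =>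
      (LinearMap.congr_fun hW (p, (0 : P' k))).trans <| by
        change v p + w 0 = v p
        rw [map_zero, add_zero]
    rcases k with _ | k
    · let W' : P 0 →ₗ[A] N := W
      refine ⟨W', fun x => ?_⟩
      rw [← hW]
      change W' (dP 0 x + f 0 0) = W' (dP 0 x)
      rw [map_zero, add_zero]
    · let W' : P (k + 1) × P' k →ₗ[A] N := W
      refine ⟨W' ∘ₗ LinearMap.inl A _ _, fun x => ?_⟩
      rw [← hW]
      change W' (dP (k + 1) x + f (k + 1) 0, -dP' k 0) = W' (dP (k + 1) x, 0)
      rw [map_zero, map_zero, add_zero, neg_zero]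

end Cone


section ExtComplex

variable {S T : Type*} [Ring S] [Ring T] {τ : S →+* T} {C : ℕ → Type*}
  [∀ l, AddCommGroup (C l)] [∀ l, Module S (C l)]

theorem pcast_pcast {a b c : ℕ} (h : a = b) (h' : b = c) (x : C a) :
    pcast (A := S) C h' (pcast (A := S) C h x) = pcast (A := S) C (h.trans h') x := by
  subst h h'
  rfl

theorem map_pcast {R : Type*} [Ring R] {σ : R →+* S} {D : ℕ → Type*} [∀ l, AddCommGroup (D l)]
    [∀ l, Module R (D l)] (f : ∀ l, D l →ₛₗ[σ] C l) {a b : ℕ} (h : a = b) (x : D a) :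
    f b (pcast (A := R) D h x) = pcast (A := S) C h (f a x) := by
  subst h
  rfl

variable {d : ∀ l, C (l + 1) →ₗ[S] C l}

theorem d_pcast {a b : ℕ} (h : a = b) (h' : a + 1 = b + 1) (x : C (a + 1)) :
    d b (pcast (A := S) C h' x) = pcast (A := S) C h (d a x) := by
  subst h
  rfl

theorem IsCob.comp_pcast {N : Type*} [AddCommGroup N] [Module T N] {a b : ℕ} (h : b = a)
    {u : C a →ₛₗ[τ] N} (hu : IsCob d a u) : IsCob d b (u.comp (pcast (A := S) C h)) := by
  subst h
  exact hu

theorem IsChainMap.apply {k : ℕ} {g : ExtDeg S C k} (hg : IsChainMap C d k g) (m : ℕ)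
    (x : C (k + m + 1)) : g m (d (k + m) x) = (-1 : ℤ) ^ k • d m (g (m + 1) x) :=
  LinearMap.congr_fun (hg m) x

/-- Precomposition with a chain map preserves coboundaries. -/
theorem IsCob.comp_chainMap {N : Type*} [AddCommGroup N] [Module T N] {k m : ℕ}
    {u : C m →ₛₗ[τ] N} (hu : IsCob d m u) {g : ExtDeg S C k} (hg : IsChainMap C d k g) :
    IsCob d (k + m) (u.comp (g m)) := by
  cases m with
  | zero => exact (isCob_zero _).congr fun x => hu _
  | succ m =>
    obtain ⟨w, hw⟩ := hu
    refine ⟨(-1 : ℤ) ^ k • w.comp (g m), fun (x : C (k + m + 1)) => ?_⟩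
    change u (g (m + 1) x) = (-1 : ℤ) ^ k • w (g m (d (k + m) x))
    rw [hw, hg.apply, map_zsmul, smul_smul, ← mul_pow]
    simp

variable {M : Type*} [AddCommGroup M] [Module T M] {π : C 0 →ₛₗ[τ] M}

theorem IsNullMap.isCob (hπd : ∀ x, π (d 0 x) = 0) {k : ℕ} {g : ExtDeg S C k}
    (hg : IsNullMap C d k g) : IsCob d (k + 0) (π.comp (g 0)) := by
  cases k with
  | zero =>
    obtain ⟨h, h0, -⟩ := hg
    intro x
    rw [h0]
    exact hπd _
  | succ k =>
    obtain ⟨h, hh⟩ := hg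
    refine ⟨-((-1 : ℤ) ^ k • π.comp (h 0)), fun x => ?_⟩
    rw [LinearMap.comp_apply, hh]
    simp [hπd]
    rfl

variable [∀ l, Module.Projective S (C l)] (hπ : Function.Surjective π) (hd0 : Function.Exact (d 0) π)
  (hd : ∀ l, Function.Exact (d (l + 1)) (d l))

include hπ hd0 hd

theorem IsChainMap.isNullMap {k : ℕ} {g : ExtDeg S C k} (hg : IsChainMap C d k g)
    (hc : IsCob d (k + 0) (π.comp (g 0))) : IsNullMap C d k g := by
  have hdd : ∀ l x, d l (d (l + 1) x) = 0 := fun l x => (hd l _).2 ⟨x, rfl⟩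
  obtain ⟨B, hB, hBπ⟩ := IsCob.exists_lift (σ := RingHom.id S) π hπ hc
  obtain ⟨H, h0, hH⟩ := exists_homotopy (c := fun m => C (k + m)) (fun m => d (k + m)) d π
    (fun m => hdd (k + m)) hd0 hd (neg_one_pow_eq_or ℤ k) g hg.apply B (hB.map_d hdd)
    (fun x => (hBπ x).symm)
  cases k with
  | zero =>
    refine ⟨fun m => H m ∘ₗ pcast C (show m = 0 + m by omega), LinearMap.ext fun x => ?_,
      fun m => LinearMap.ext fun x => ?_⟩
    · have : B x = 0 := hB x
      rw [h0, this, add_zero]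
      rfl
    · rw [hH]
      simp only [LinearMap.comp_apply, LinearMap.add_apply, pcast_pcast]
      rw [d_pcast (show 0 + m = m by omega), pcast_pcast, pow_zero, one_smul]
      rfl
  | succ k =>
    obtain ⟨b, hb⟩ := hB
    refine ⟨fun m => match m with
      | 0 => -((-1 : ℤ) ^ k • b)
      | m + 1 => H m ∘ₗ pcast C (show k + (m + 1) = k + 1 + m by omega), fun m => ?_⟩
    cases m with
    | zero =>
      refine LinearMap.ext fun x => ?_
      rw [h0, hb]
      simp [pcast_pcast, smul_smul, ← mul_pow]
      rfl
    | succ m =>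
      refine LinearMap.ext fun x => ?_
      rw [hH]
      have := d_pcast (d := d) (show k + (m + 1) = k + 1 + m by omega) (by omega)
        (pcast (A := S) C (show k + 1 + (m + 1) = k + (m + 1) + 1 by omega) x)
      rw [pcast_pcast] at this
      simp [pcast_pcast, pow_succ, ← this, sub_eq_add_neg]
      rfl

theorem exists_isChainMap {k : ℕ} (u : C (k + 0) →ₛₗ[τ] M) (hu : ∀ x, u (d (k + 0) x) = 0) :
    ∃ g : ExtDeg S C k, IsChainMap C d k g ∧ ∀ x, π (g 0 x) = u x := by
  have hdd : ∀ l x, d l (d (l + 1) x) = 0 := fun l x => (hd l _).2 ⟨x, rfl⟩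
  obtain ⟨g, h0, hg⟩ := exists_chainMap (σ := RingHom.id S) (c := fun m => C (k + m))
    (fun m => d (k + m)) d π (fun m => hdd (k + m)) hπ hd0 hd (neg_one_pow_eq_or ℤ k) u hu
  exact ⟨g, fun m => LinearMap.ext (hg m), h0⟩

end ExtComplex

section Comparison

theorem exists_quotient_equiv {K V W : Type*} [Ring K] [AddCommGroup V] [Module K V]
    [AddCommGroup W] [Module K W] (N : Submodule K V) (N' : Submodule K W)
    (G : Submodule K (V × W)) (hl : ∀ v, ∃ w, (v, w) ∈ G) (hr : ∀ w, ∃ v, (v, w) ∈ G)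
    (hN : ∀ v, (v, 0) ∈ G ↔ v ∈ N) (hN' : ∀ w, (0, w) ∈ G ↔ w ∈ N') :
    ∃ φ : (V ⧸ N) ≃ₗ[K] (W ⧸ N'), ∀ v w,
      φ (Submodule.Quotient.mk v) = Submodule.Quotient.mk w ↔ (v, w) ∈ G := by
  have key : ∀ {v w}, (v, w) ∈ G → (v ∈ N ↔ w ∈ N') := fun {v w} h => by
    rw [← hN, ← hN']
    constructor <;> intro h'
    · simpa using G.sub_mem h h'
    · simpa using G.sub_mem h h'
  let p : G →ₗ[K] V ⧸ N := N.mkQ ∘ₗ LinearMap.fst K V W ∘ₗ G.subtype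
  let q : G →ₗ[K] W ⧸ N' := N'.mkQ ∘ₗ LinearMap.snd K V W ∘ₗ G.subtype
  have hp : Function.Surjective p := fun x => by
    obtain ⟨v, rfl⟩ := N.mkQ_surjective x
    obtain ⟨w, h⟩ := hl v
    exact ⟨⟨_, h⟩, rfl⟩
  have hq : Function.Surjective q := fun x => by
    obtain ⟨w, rfl⟩ := N'.mkQ_surjective x
    obtain ⟨v, h⟩ := hr w
    exact ⟨⟨_, h⟩, rfl⟩
  have hpq : LinearMap.ker p = LinearMap.ker q := by
    ext ⟨⟨v, w⟩, h⟩
    simpa [p, q] using key h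
  let φ := (p.quotKerEquivOfSurjective hp).symm ≪≫ₗ Submodule.quotEquivOfEq _ _ hpq ≪≫ₗ
    q.quotKerEquivOfSurjective hq
  have hφ : ∀ g : G, φ (p g) = q g := fun g => by
    have : (p.quotKerEquivOfSurjective hp).symm (p g) = Submodule.Quotient.mk g := by
      rw [LinearEquiv.symm_apply_eq]
      rfl
    simp only [φ, LinearEquiv.trans_apply, this]
    rfl
  have hφ' : ∀ {v w}, (v, w) ∈ G → φ (Submodule.Quotient.mk v) = Submodule.Quotient.mk w :=
    fun h => hφ ⟨_, h⟩
  refine ⟨φ, fun v w => ⟨fun h => ?_, hφ'⟩⟩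
  obtain ⟨w', hw'⟩ := hl v
  have h1 : w - w' ∈ N' := (Submodule.Quotient.eq N').1 (h.symm.trans (hφ' hw'))
  simpa using G.add_mem hw' ((hN' _).2 h1)

section

variable {S T : Type*} [Ring S] [Ring T] {τ : S →+* T} {C : ℕ → Type*}
  [∀ l, AddCommGroup (C l)] [∀ l, Module S (C l)] {d : ∀ l, C (l + 1) →ₗ[S] C l}
  {K : Type*} [Field K] [Algebra K S] [∀ l, Module K (C l)] [∀ l, IsScalarTower K S (C l)]
  [∀ l, SMulCommClass S K (C l)]

theorem IsCob.of_smul {N : Type*} [AddCommGroup N] [Module T N] {l : ℕ} {u v : C l →ₛₗ[τ] N}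
    (hu : IsCob d l u) (c : K) (h : ∀ x, v x = u (c • x)) : IsCob d l v := by
  cases l with
  | zero => exact fun x => (h x).trans (hu _)
  | succ l =>
    obtain ⟨w, hw⟩ := hu
    exact ⟨w.comp (c • LinearMap.id : C l →ₗ[S] C l), fun x => by
      simp [h, hw, LinearMap.map_smul_of_tower]⟩

theorem mem_chainSub {k : ℕ} {g : ExtDeg S C k} : g ∈ chainSub C d K k ↔ IsChainMap C d k g := by
  refine ⟨fun h => ?_, fun h => Submodule.subset_span h⟩
  induction h using Submodule.span_induction with
  | mem g h => exact h
  | zero => exact fun m => LinearMap.ext fun x => by simp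
  | add g g' _ _ h h' => exact fun m => LinearMap.ext fun x => by simp [h.apply, h'.apply]
  | smul c g _ h =>
    exact fun m => LinearMap.ext fun x => by
      simp [h.apply, LinearMap.map_smul_of_tower, smul_comm c]

variable {M : Type*} [AddCommGroup M] [Module T M] {π : C 0 →ₛₗ[τ] M}
  [∀ l, Module.Projective S (C l)]

theorem mem_nullSub_iff (hπ : Function.Surjective π) (hd0 : Function.Exact (d 0) π)
    (hd : ∀ l, Function.Exact (d (l + 1)) (d l)) {k : ℕ} {g : ExtDeg S C k}
    (hg : IsChainMap C d k g) :
    g ∈ nullSub C d K k ↔ IsCob d (k + 0) (π.comp (g 0)) := by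
  refine ⟨fun h => ?_, fun h => Submodule.subset_span (hg.isNullMap hπ hd0 hd h)⟩
  clear hg
  induction h using Submodule.span_induction with
  | mem g h => exact IsNullMap.isCob (fun x => (hd0 _).2 ⟨x, rfl⟩) h
  | zero => exact (isCob_zero _).congr fun x => by simp
  | add g g' _ _ h h' => exact (h.add h').congr fun x => by simp
  | smul c g _ h => exact h.of_smul c fun x => by simp [LinearMap.map_smul_of_tower]

end

variable {A A' : Type*} [Ring A] [Ring A'] {ρ : A →+* A'}
  {P : ℕ → Type*} [∀ l, AddCommGroup (P l)] [∀ l, Module A' (P l)]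
  {dP : ∀ l, P (l + 1) →ₗ[A'] P l}
  {P' : ℕ → Type*} [∀ l, AddCommGroup (P' l)] [∀ l, Module A (P' l)]
  {dP' : ∀ l, P' (l + 1) →ₗ[A] P' l}
  {M : Type*} [AddCommGroup M] [Module A' M]

/-- Degree `k` families on `P` and `P'` correspond to each other along a chain map `f : P' → P`
of augmented complexes if they induce the same class in the cohomology of `Hom(P', M)`. -/
def Corresponds (dP' : ∀ l, P' (l + 1) →ₗ[A] P' l) (π : P 0 →ₗ[A'] M) (π' : P' 0 →ₛₗ[ρ] M)
    (f : ∀ l, P' l →ₛₗ[ρ] P l) {k : ℕ} (x : ExtDeg A' P k) (x' : ExtDeg A P' k) : Prop :=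
  IsCob dP' (k + 0) ((π.comp (x 0)).comp (f (k + 0)) - π'.comp (x' 0))

variable {π : P 0 →ₗ[A'] M} {π' : P' 0 →ₛₗ[ρ] M} {f : ∀ l, P' l →ₛₗ[ρ] P l}

theorem IsCob.comp_comparison (hf : ∀ l x, f l (dP' l x) = dP l (f (l + 1) x)) {l : ℕ}
    {v : P l →ₗ[A'] M} (hv : IsCob dP l v) : IsCob dP' l (v.comp (f l)) := by
  cases l with
  | zero => exact fun x => hv _
  | succ l =>
    obtain ⟨w, hw⟩ := hv
    exact ⟨w.comp (f l), fun x => by simp [hw, hf]⟩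

theorem corresponds_extId (hf0 : ∀ x, π (f 0 x) = π' x) :
    Corresponds dP' π π' f (extId P) (extId P') := fun x => sub_eq_zero.2 (hf0 x)

theorem Corresponds.extComp [∀ l, Module.Projective A (P' l)]
    (hπ : Function.Surjective π) (hP0 : Function.Exact (dP 0) π)
    (hP : ∀ l, Function.Exact (dP (l + 1)) (dP l))
    (hdd' : ∀ l x, dP' l (dP' (l + 1) x) = 0)
    (hf0 : ∀ x, π (f 0 x) = π' x) (hf : ∀ l x, f l (dP' l x) = dP l (f (l + 1) x)) {j k : ℕ}
    {x : ExtDeg A' P j} {x' : ExtDeg A P' j} {y : ExtDeg A' P k} {y' : ExtDeg A P' k}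
    (hx : IsChainMap P dP j x) (hy : IsChainMap P dP k y) (hy' : IsChainMap P' dP' k y')
    (hxx' : Corresponds dP' π π' f x x') (hyy' : Corresponds dP' π π' f y y') :
    Corresponds dP' π π' f (extComp P x y) (extComp P' x' y') := by
  obtain ⟨B, hB, hBπ⟩ := hyy'.exists_lift (σ := ρ) π hπ
  obtain ⟨H, h0, hH⟩ := exists_homotopy (c := fun m => P' (k + m)) (fun m => dP' (k + m)) dP π
    (fun m => hdd' (k + m)) hP0 hP (neg_one_pow_eq_or ℤ k)
    (fun m => (y m).comp (f (k + m)) - (f m).comp (y' m))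
    (fun m p => by
      have h1 : f (k + m) (dP' (k + m) p) = dP (k + m) (f (k + m + 1) p) := hf _ _
      have h2 := hy'.apply m p
      have h3 := hy.apply m (f (k + m + 1) p)
      change y m (f (k + m) (dP' (k + m) p)) - f m (y' m (dP' (k + m) p)) = (-1 : ℤ) ^ k •
        dP m (y (m + 1) (f (k + (m + 1)) p) - f (m + 1) (y' (m + 1) p))
      rw [h1, h2, h3, map_zsmul, hf, map_sub, smul_sub]
      rfl) B (hB.map_d hdd')
    (fun p => by simp [hBπ, hf0])
  have key : ∀ m (u : P m →ₗ[A'] M), (∀ p, u (dP m p) = 0) →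
      IsCob dP' (k + m) (u.comp ((y m).comp (f (k + m)) - (f m).comp (y' m))) := by
    intro m u hu
    cases m with
    | zero =>
      exact (hB.comp u).congr fun p => (congrArg u (h0 p)).trans (by simp [hu])
    | succ m =>
      exact ⟨(-1 : ℤ) ^ k • u.comp (H m), fun p =>
        (congrArg u (hH m p)).trans (by simp [hu])⟩
  have hu : ∀ p, (π.comp (x 0)) (dP (j + 0) p) = 0 := fun p => by
    rw [LinearMap.comp_apply, hx.apply, map_zsmul, (hP0 _).2 ⟨_, rfl⟩, smul_zero]
  refine (((key (j + 0) _ hu).add (hxx'.comp_chainMap hy')).comp_pcast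
    (show j + k + 0 = k + (j + 0) by omega)).congr fun p => ?_
  have := map_pcast f (show j + k + 0 = k + (j + 0) by omega) p
  change π (x 0 (y (j + 0) (pcast P _ (f (j + k + 0) p)))) -
    π' (x' 0 (y' (j + 0) (pcast P' _ p))) = _
  rw [← this]
  simp

variable {K : Type*} [Field K] [Algebra K A] [Algebra K A']
  [∀ l, Module K (P l)] [∀ l, IsScalarTower K A' (P l)] [∀ l, SMulCommClass A' K (P l)]
  [∀ l, Module K (P' l)] [∀ l, IsScalarTower K A (P' l)] [∀ l, SMulCommClass A K (P' l)]

/-- The correspondence of families on `P` and `P'` as a linear relation between chain maps. -/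
def correspondence (dP : ∀ l, P (l + 1) →ₗ[A'] P l) (dP' : ∀ l, P' (l + 1) →ₗ[A] P' l)
    (π : P 0 →ₗ[A'] M) (π' : P' 0 →ₛₗ[ρ] M) (f : ∀ l, P' l →ₛₗ[ρ] P l)
    (hfK : ∀ l (c : K) x, f l (c • x) = c • f l x) (k : ℕ) :
    Submodule K (chainSub P dP K k × chainSub P' dP' K k) where
  carrier := {g | Corresponds dP' π π' f g.1.1 g.2.1}
  zero_mem' := (isCob_zero _).congr fun x => by simp
  add_mem' {g g'} h h' := (IsCob.add h h').congr fun x => by simp; abel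
  smul_mem' c g h := IsCob.of_smul h c fun x => by simp [LinearMap.map_smul_of_tower, hfK]

theorem exists_isGradedExtAlgIso [∀ l, Module.Projective A' (P l)]
    [∀ l, Module.Projective A (P' l)]
    (hρalg : ∀ c : K, ρ (algebraMap K A c) = algebraMap K A' c)
    (hπ : Function.Surjective π) (hP0 : Function.Exact (dP 0) π)
    (hP : ∀ l, Function.Exact (dP (l + 1)) (dP l))
    (hπ' : Function.Surjective π') (hP'0 : Function.Exact (dP' 0) π')
    (hP' : ∀ l, Function.Exact (dP' (l + 1)) (dP' l))
    (hf0 : ∀ x, π (f 0 x) = π' x) (hf : ∀ l x, f l (dP' l x) = dP l (f (l + 1) x))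
    (hsurj : ∀ k (u : P' k →ₛₗ[ρ] M), (∀ x, u (dP' k x) = 0) →
      ∃ v : P k →ₗ[A'] M, (∀ x, v (dP k x) = 0) ∧ IsCob dP' k (u - v.comp (f k)))
    (hinj : ∀ k (v : P k →ₗ[A'] M), (∀ x, v (dP k x) = 0) → IsCob dP' k (v.comp (f k)) →
      IsCob dP k v) :
    ∃ φ : ∀ k, extQ P dP K k ≃ₗ[K] extQ P' dP' K k, IsGradedExtAlgIso P dP P' dP' K φ := by
  have hdd : ∀ l x, dP l (dP (l + 1) x) = 0 := fun l x => (hP l _).2 ⟨x, rfl⟩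
  have hdd' : ∀ l x, dP' l (dP' (l + 1) x) = 0 := fun l x => (hP' l _).2 ⟨x, rfl⟩
  have hπd : ∀ x, π (dP 0 x) = 0 := fun x => (hP0 _).2 ⟨x, rfl⟩
  have hπd' : ∀ x, π' (dP' 0 x) = 0 := fun x => (hP'0 _).2 ⟨x, rfl⟩
  have hfK : ∀ l (c : K) x, f l (c • x) = c • f l x := fun l c x => by
    rw [← algebraMap_smul A c x, map_smulₛₗ, hρalg, algebraMap_smul]
  have hcocycle : ∀ {k} {g : ExtDeg A' P k}, IsChainMap P dP k g →
      ∀ x, (π ∘ₗ g 0) (dP (k + 0) x) = 0 := fun hg x => by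
    rw [LinearMap.comp_apply, hg.apply, map_zsmul, hπd, smul_zero]
  have hφ : ∀ k, ∃ φ : extQ P dP K k ≃ₗ[K] extQ P' dP' K k,
      ∀ x x', φ (Submodule.Quotient.mk x) = Submodule.Quotient.mk x' ↔
        (x, x') ∈ correspondence dP dP' π π' f hfK k := fun k => by
    refine exists_quotient_equiv _ _ _ ?_ ?_ ?_ ?_
    · rintro ⟨x, hx⟩
      obtain ⟨x', hx', h⟩ := exists_isChainMap hπ' hP'0 hP'
        ((π ∘ₗ x 0).comp (f (k + 0))) fun p => by
          rw [LinearMap.comp_apply, hf]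
          exact hcocycle (mem_chainSub.1 hx) _
      exact ⟨⟨x', mem_chainSub.2 hx'⟩, (isCob_zero _).congr fun p => sub_eq_zero.2 (h p).symm⟩
    · rintro ⟨x', hx'⟩
      obtain ⟨v, hv, hvx⟩ := hsurj (k + 0) (π'.comp (x' 0)) fun p => by
        rw [LinearMap.comp_apply, (mem_chainSub.1 hx').apply, map_zsmul, hπd', smul_zero]
      obtain ⟨x, hx, h⟩ := exists_isChainMap hπ hP0 hP v hv
      exact ⟨⟨x, mem_chainSub.2 hx⟩, hvx.neg.congr fun p => by simp [h]⟩
    · rintro ⟨x, hx⟩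
      have hx := mem_chainSub.1 hx
      refine Iff.trans ?_ (mem_nullSub_iff (K := K) hπ hP0 hP hx).symm
      refine ⟨fun h => hinj _ _ (hcocycle hx) (IsCob.congr h fun p => by simp),
        fun h => (IsCob.comp_comparison hf h).congr fun p => by simp⟩
    · rintro ⟨x', hx'⟩
      refine Iff.trans ?_ (mem_nullSub_iff (K := K) hπ' hP'0 hP' (mem_chainSub.1 hx')).symm
      exact ⟨fun h => (IsCob.neg h).congr fun p => by simp,
        fun h => (IsCob.neg h).congr fun p => by simp⟩
  choose φ hφ using hφ
  refine ⟨φ, fun hid hid' => (hφ 0 _ _).2 (corresponds_extId (dP' := dP') hf0), ?_⟩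
  intro j k x y hx hy hxy x' y' hx' hy' hxy' h h'
  exact (hφ _ _ _).2 (Corresponds.extComp hπ hP0 hP hdd' hf0 hf hx hy hy' ((hφ _ _ _).1 h)
    ((hφ _ _ _).1 h'))

end Comparison
section Inflation

variable {A A' : Type u} [Ring A] [Ring A'] {ε : A} {ρ : A →+* A'}
  {P : ℕ → Type u} [∀ l, AddCommGroup (P l)] [∀ l, Module A' (P l)]
  [∀ l, Module.Projective A' (P l)] {dP : ∀ l, P (l + 1) →ₗ[A'] P l}
  {P' : ℕ → Type u} [∀ l, AddCommGroup (P' l)] [∀ l, Module A (P' l)]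
  [∀ l, Module.Projective A (P' l)] {dP' : ∀ l, P' (l + 1) →ₗ[A] P' l}
  {M : Type u} [AddCommGroup M] [Module A' M] {π : P 0 →ₗ[A'] M} {π' : P' 0 →ₛₗ[ρ] M}
  {f : ∀ l, P' l →ₛₗ[ρ] P l}

/-- If `A → A'` is the quotient by a trace ideal with a resolved trace, then inflation induces
isomorphisms on `Ext`, here stated in terms of cocycles and coboundaries. -/
theorem HasResolvedTrace.comparison (hA : HasResolvedTrace ε A)
    (hρsurj : Function.Surjective ρ) (hρker : ∀ a, ρ a = 0 ↔ a ∈ traceSub ε A)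
    (hP0 : Function.Exact (dP 0) π) (hP : ∀ l, Function.Exact (dP (l + 1)) (dP l))
    (hπ' : Function.Surjective π') (hP'0 : Function.Exact (dP' 0) π')
    (hP' : ∀ l, Function.Exact (dP' (l + 1)) (dP' l))
    (hf0 : ∀ x, π (f 0 x) = π' x) (hf : ∀ l x, f l (dP' l x) = dP l (f (l + 1) x)) :
    (∀ k (u : P' k →ₛₗ[ρ] M), (∀ x, u (dP' k x) = 0) →
      ∃ v : P k →ₗ[A'] M, (∀ x, v (dP k x) = 0) ∧ IsCob dP' k (u - v.comp (f k))) ∧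
    ∀ k (v : P k →ₗ[A'] M), (∀ x, v (dP k x) = 0) → IsCob dP' k (v.comp (f k)) →
      IsCob dP k v := by
  let _ : ∀ l, Module A (P l) := fun l => Module.compHom (P l) ρ
  let _ : Module A M := Module.compHom M ρ
  have hρε : ρ ε = 0 := (hρker ε).2 (by simpa using smul_mem_traceSub (ε := ε) (1 : A))
  have hM : ∀ x : M, ε • x = 0 := fun x => by
    change ρ ε • x = 0
    rw [hρε, zero_smul]
  have hPM : ∀ l k, ExtVanishes A (P l) M (k + 1) := fun l k =>
    hA.extVanishes_of_projective_quotient ρ hρsurj hρker (fun _ _ => rfl) hM k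
  let dA : ∀ l, P (l + 1) →ₗ[A] P l := fun l =>
    { toFun := dP l, map_add' := map_add _, map_smul' := fun a x => map_smul (dP l) (ρ a) x }
  let fA : ∀ l, P' l →ₗ[A] P l := fun l =>
    { toFun := f l, map_add' := map_add _, map_smul' := fun a x => map_smulₛₗ (f l) a x }
  let πA : P 0 →ₗ[A] M :=
    { toFun := π, map_add' := map_add _, map_smul' := fun a x => map_smul π (ρ a) x }
  let πA' : P' 0 →ₗ[A] M :=
    { toFun := π', map_add' := map_add _, map_smul' := fun a x => map_smulₛₗ π' a x }
  let up : ∀ {l}, (P l →ₗ[A] M) → (P l →ₗ[A'] M) := fun v =>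
    { toFun := v
      map_add' := map_add _
      map_smul' := fun b x => by
        obtain ⟨a, rfl⟩ := hρsurj b
        exact map_smul v a x }
  let down : ∀ {l}, (P l →ₗ[A'] M) → (P l →ₗ[A] M) := fun v =>
    { toFun := v, map_add' := map_add _, map_smul' := fun a x => map_smul v (ρ a) x }
  let up' : ∀ {l}, (P' l →ₗ[A] M) → (P' l →ₛₗ[ρ] M) := fun v =>
    { toFun := v, map_add' := map_add _, map_smul' := fun a x => map_smul v a x }
  let down' : ∀ {l}, (P' l →ₛₗ[ρ] M) → (P' l →ₗ[A] M) := fun v =>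
    { toFun := v, map_add' := map_add _, map_smul' := fun a x => map_smulₛₗ v a x }
  refine ⟨fun k u hu => ?_, fun k v hv hvf => ?_⟩
  · obtain ⟨v, hv, h⟩ := exists_isCob_sub_comp (dP := dA) (f := fA) (π := πA) (π' := πA')
      hP0 hP hπ' hP'0 hP' hf0 hf hPM (down' u) hu
    refine ⟨up v, hv, ?_⟩
    cases k with
    | zero => exact h
    | succ k =>
      obtain ⟨w, hw⟩ := h
      exact ⟨up' w, hw⟩
  · have h : IsCob dA k (down v) := by
      refine isCob_of_isCob_comp (dP := dA) (f := fA) (π := πA) (π' := πA')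
        hP0 hP hπ' hP'0 hP' hf0 hf hPM (down v) hv ?_
      cases k with
      | zero => exact hvf
      | succ k =>
        obtain ⟨w, hw⟩ := hvf
        exact ⟨down' w, hw⟩
    cases k with
    | zero => exact h
    | succ k =>
      obtain ⟨w, hw⟩ := h
      exact ⟨up w, hw⟩

end Inflation

theorem mem_traceSub_iff_mem_span {A : Type*} [Ring A] {ε a : A} :
    a ∈ traceSub ε A ↔ a ∈ Submodule.span A {x | ∃ u v : A, x = u * ε * v} := by
  suffices h : traceSub ε A = Submodule.span A {x | ∃ u v : A, x = u * ε * v} by rw [h]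
  refine le_antisymm (Submodule.span_mono ?_) (Submodule.span_le.2 ?_)
  · rintro _ ⟨v, rfl⟩
    exact ⟨1, v, by simp⟩
  · rintro _ ⟨u, v, rfl⟩
    rw [mul_assoc]
    exact Submodule.smul_mem _ u (smul_mem_traceSub v)


theorem stmt9
    {K : Type u} [Field K] [IsAlgClosed K]
    {A : Type u} [Ring A] [Algebra K A] [FiniteDimensional K A]
    (n : ℕ) (e : Fin n → A)
    (hidem : ∀ i, IsPrimitiveIdem A (e i))
    (horth : ∀ i j, i ≠ j → e i * e j = 0)
    (hcomplete : ∑ i, e i = 1)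
    -- `A` is basic
    (hbasic : ∀ i j, i ≠ j → ¬ Nonempty (↥(leftIdeal A (e i)) ≃ₗ[A] ↥(leftIdeal A (e j))))
    -- `A` is `Δ̄`-filtered
    (hfilt : ∀ i, HasPStdFilt A e (fun j => i ≤ j) ↥(leftIdeal A (e i)))
    (i : Fin n)
    -- `A' = A/AεA`, `ε = e_{i+1} + ⋯ + e_n`
    (A' : Type u) [Ring A'] [Algebra K A'] (ρ : A →+* A')
    (hρsurj : Function.Surjective ρ)
    (hρalg : ∀ c : K, ρ (algebraMap K A c) = algebraMap K A' c)
    (hρker : ∀ a : A, ρ a = 0 ↔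
      a ∈ Submodule.span A {x | ∃ u v : A, x = u * (sumLater A e i) * v}) :
    -- (a) `AεA` annihilates the properly standard `A`-module `Δ̄(i)`
    (∀ (u v : A) (x : PStd A e i), (u * (sumLater A e i) * v) • x = 0) ∧
    -- (b) `Δ̄(i)`, regarded as an `A'`-module, is the properly standard `A'`-module
    -- `Δ̄_{A'}(i)`: there is a `ρ`-semilinear additive bijection
    (∃ f : PStd A e i ≃+ PStd A' (fun j => ρ (e j)) i,
      ∀ (a : A) (x : PStd A e i), f (a • x) = ρ a • f x) ∧
    -- (c) `Ext^*_{A'}(Δ̄(i),Δ̄(i)) ≅ Ext^*_A(Δ̄(i),Δ̄(i))` as ℤ-graded `K`-algebras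
    (∀ (P : ℕ → Type u) [∀ l, AddCommGroup (P l)] [∀ l, Module A' (P l)]
      [∀ l, Module K (P l)] [∀ l, IsScalarTower K A' (P l)] [∀ l, SMulCommClass A' K (P l)],
      (∀ l, Module.Projective A' (P l)) →
      ∀ (dP : ∀ l, P (l + 1) →ₗ[A'] P l) (π : P 0 →ₗ[A'] PStd A' (fun j => ρ (e j)) i),
      Function.Surjective π → Function.Exact (dP 0) π →
      (∀ l, Function.Exact (dP (l + 1)) (dP l)) →
      ∀ (P' : ℕ → Type u) [∀ l, AddCommGroup (P' l)] [∀ l, Module A (P' l)]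
      [∀ l, Module K (P' l)] [∀ l, IsScalarTower K A (P' l)] [∀ l, SMulCommClass A K (P' l)],
      (∀ l, Module.Projective A (P' l)) →
      ∀ (dP' : ∀ l, P' (l + 1) →ₗ[A] P' l) (π' : P' 0 →ₗ[A] PStd A e i),
      Function.Surjective π' → Function.Exact (dP' 0) π' →
      (∀ l, Function.Exact (dP' (l + 1)) (dP' l)) →
      ∃ φ : ∀ k, extQ P dP K k ≃ₗ[K] extQ P' dP' K k,
        IsGradedExtAlgIso P dP P' dP' K φ) := by
  have hB : IsBasicSystem e := ⟨hidem, horth, hcomplete, hbasic⟩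
  have hρker' : ∀ a, ρ a = 0 ↔ a ∈ traceSub (sumLater A e i) A := fun a =>
    (hρker a).trans mem_traceSub_iff_mem_span.symm
  obtain ⟨θ, hθ⟩ := hB.exists_pStd_addEquiv K i ρ hρsurj hρker'
  refine ⟨fun u v x => ?_, ⟨θ, hθ⟩, ?_⟩
  · rw [mul_smul, mul_smul, hB.sumLater_smul K le_rfl, smul_zero]
  intro P _ _ _ _ _ hPproj dP π hπ hP0 hP P' _ _ _ _ _ hP'proj dP' π' hπ' hP'0 hP'
  let θ' : P' 0 →ₛₗ[ρ] PStd A' (fun j => ρ (e j)) i :=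
    { toFun := fun x => θ (π' x)
      map_add' := fun x y => by rw [map_add, map_add]
      map_smul' := fun a x => by rw [map_smul, hθ] }
  have hθ' : Function.Surjective θ' := θ.surjective.comp hπ'
  have hθ'0 : Function.Exact (dP' 0) θ' := fun x => by
    rw [← hP'0 x]
    exact map_eq_zero_iff θ θ.injective
  have hdd' : ∀ l x, dP' l (dP' (l + 1) x) = 0 := fun l x => (hP' l _).2 ⟨x, rfl⟩
  obtain ⟨f, hf0, hf⟩ := exists_chainMap (σ := ρ) dP' dP π hdd' hπ hP0 hP (Or.inl rfl) θ'
    fun x => (hθ'0 _).2 ⟨x, rfl⟩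
  have hf : ∀ l x, f l (dP' l x) = dP l (f (l + 1) x) := fun l x => by rw [hf, one_smul]
  obtain ⟨hsurj, hinj⟩ := (hB.hasResolvedTrace K hfilt i).comparison hρsurj hρker' hP0 hP hθ' hθ'0
    hP' hf0 hf
  exact exists_isGradedExtAlgIso hρalg hπ hP0 hP hθ' hθ'0 hP' hf0 hf hsurj hinj

end
end
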